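/- For every a ∈ (0, 2/3) with a ≠ 1/3 and every k ≥ 1, the set of points x ∈ (0,1) such that M_{k,a}'(x) = 0 but M_{k+1,a} does not have a finite derivative at x has positive Hausdorff dimension; in particular, this set is uncountable. Consequently, the sets D⁰_{k,a} := {x ∈ (0,1) : M_{k,a}'(x) = 0} satisfy D⁰_{0,a} ⊋ D⁰_{1,a} ⊋ D⁰_{2,a} ⊋ ⋯. -/

import Mathlib

open Filter Topology MeasureTheory Set
open scoped ENNReal

/-- The `(n+1)`-th ternary digit of `x` (choosing the expansion ending in all `0`s
when two expansions exist, and the all-`2`s expansion for `x = 1`). -/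
noncomputable def tDigit (x : ℝ) (n : ℕ) : ℕ :=
  if x = 1 then 2 else (⌊(3:ℝ) ^ (n + 1) * x⌋ - 3 * ⌊(3:ℝ) ^ n * x⌋).toNat

/-- `l_n(x)`: the number of `1`s among the first `n` ternary digits of `x`. -/
noncomputable def lCount (x : ℝ) (n : ℕ) : ℕ :=
  ((Finset.range n).filter (fun i => tDigit x i = 1)).card

/-- `q_a(d)` with `q_a(0)=0`, `q_a(1)=a`, `q_a(2)=1-a`. -/
noncomputable def qDig (a : ℝ) (d : ℕ) : ℝ :=
  if d = 0 then 0 else if d = 1 then a else 1 - a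

/-- Okamoto's function `F_a`. -/
noncomputable def Okamoto (a x : ℝ) : ℝ :=
  ∑' n : ℕ, a ^ (n - lCount x n) * (1 - 2 * a) ^ lCount x n * qDig a (tDigit x n)

/-- `M_{k,a}(x)`: the `k`-th partial derivative of `F_a(x)` with respect to `a`. -/
noncomputable def Mfun (k : ℕ) (a x : ℝ) : ℝ :=
  iteratedDeriv k (fun b => Okamoto b x) a

/-- `f` has derivative `+∞` at `x` (difference quotients over `y ∈ [0,1] \ {x}`). -/
def derivPInf (f : ℝ → ℝ) (x : ℝ) : Prop :=
  Tendsto (fun y => (f y - f x) / (y - x)) (𝓝[Set.Icc 0 1 \ {x}] x) atTop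

/-- `f` has derivative `-∞` at `x`. -/
def derivMInf (f : ℝ → ℝ) (x : ℝ) : Prop :=
  Tendsto (fun y => (f y - f x) / (y - x)) (𝓝[Set.Icc 0 1 \ {x}] x) atBot

noncomputable def phiOk (a : ℝ) : ℝ :=
  if a = 1/3 then 1/3 else if a = 1/2 then 0
  else Real.log (3 * a) / (Real.log a - Real.log |1 - 2 * a|)

noncomputable def C0 (a : ℝ) : ℝ := 1 / (Real.log a - Real.log |1 - 2 * a|)

noncomputable def hEnt (p : ℝ) : ℝ :=
  (-(p * Real.log p) - (1 - p) * Real.log (1 - p) + (1 - p) * Real.log 2) / Real.log 3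

noncomputable def dOk (a : ℝ) : ℝ := hEnt (phiOk a)

noncomputable def dTilde (a : ℝ) : ℝ := hEnt (1 - 2 * a)

section

open scoped Polynomial

open Polynomial (X C derivative eval)

/-- The contraction factor of the branch of `F_b` belonging to the ternary digit `d`, as a
polynomial in `b`. -/
noncomputable def wtPoly (d : ℕ) : ℝ[X] := if d = 1 then 1 - 2 * X else X

/-- The translation part of the branch of `F_b` belonging to the ternary digit `d`, as a
polynomial in `b`. -/
noncomputable def qPoly (d : ℕ) : ℝ[X] := if d = 0 then 0 else if d = 1 then X else 1 - X

/-- The product of the contraction factors of the first `n` digits of `e`. -/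
noncomputable def wtProd (e : ℕ → ℕ) (n : ℕ) : ℝ[X] := ∏ i ∈ Finset.range n, wtPoly (e i)

/-- The `n`-th term of the series of Okamoto's function for the digit sequence `e`. -/
noncomputable def termPoly (e : ℕ → ℕ) (n : ℕ) : ℝ[X] := wtProd e n * qPoly (e n)

lemma derivative_wtPoly (d : ℕ) :
    derivative (wtPoly d) = C (if d = 1 then -2 else 1) := by
  unfold wtPoly
  split_ifs
  · simp [← Polynomial.C_ofNat]
  · simp

lemma derivative_qPoly (d : ℕ) :
    derivative (qPoly d) = C (if d = 0 then 0 else if d = 1 then 1 else -1) := by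
  unfold qPoly
  split_ifs <;> simp

lemma iterate_derivative_mul_affine {w : ℝ[X]} {c : ℝ} (hw : derivative w = C c) (T : ℝ[X])
    (j : ℕ) : derivative^[j + 1] (T * w) =
      derivative^[j + 1] T * w + (j + 1 : ℝ[X]) * derivative^[j] T * C c := by
  induction j with
  | zero => simp [Polynomial.derivative_mul, hw]
  | succ j ih =>
    rw [Function.iterate_succ_apply', ih]
    simp only [Polynomial.derivative_mul, Polynomial.derivative_add, hw,
      ← Function.iterate_succ_apply' (f := derivative), Polynomial.derivative_C,
      Polynomial.derivative_natCast, Polynomial.derivative_one]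
    push_cast
    ring

lemma eval_iterate_derivative_mul_affine {w : ℝ[X]} {c : ℝ} (hw : derivative w = C c)
    (T : ℝ[X]) (j : ℕ) (b : ℝ) : (derivative^[j + 1] (T * w)).eval b =
      (derivative^[j + 1] T).eval b * w.eval b + (j + 1) * (derivative^[j] T).eval b * c := by
  rw [iterate_derivative_mul_affine hw]
  simp

lemma wtProd_succ (e : ℕ → ℕ) (n : ℕ) :
    wtProd e (n + 1) = wtProd e n * wtPoly (e n) := by
  simp [wtProd, Finset.prod_range_succ]

lemma abs_eval_wtPoly_le {r b : ℝ} (h1 : |b| ≤ r) (h2 : |1 - 2 * b| ≤ r) (d : ℕ) :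
    |(wtPoly d).eval b| ≤ r := by
  unfold wtPoly
  split_ifs <;> simpa

lemma abs_eval_qPoly_le {b : ℝ} (h1 : |b| ≤ 1) (d : ℕ) : |(qPoly d).eval b| ≤ 2 := by
  rw [abs_le] at h1
  unfold qPoly
  split_ifs
  · simp
  · simpa [abs_le] using ⟨by linarith, by linarith⟩
  · simpa [abs_le] using ⟨by linarith, by linarith⟩

lemma exists_bound_wtProd {r ρ : ℝ} (hr : 0 ≤ r) (hρ : r < ρ) (j : ℕ) :
    ∃ K : ℝ, 0 ≤ K ∧ ∀ (e : ℕ → ℕ) (b : ℝ), |b| ≤ r → |1 - 2 * b| ≤ r → ∀ n,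
      |(derivative^[j] (wtProd e n)).eval b| ≤ K * ρ ^ n := by
  have hρ0 : 0 < ρ := hr.trans_lt hρ
  induction j with
  | zero =>
    refine ⟨1, zero_le_one, fun e b h1 h2 n => ?_⟩
    induction n with
    | zero => simp [wtProd]
    | succ n ih =>
      simp only [Function.iterate_zero, id_eq, one_mul] at ih ⊢
      rw [wtProd_succ, Polynomial.eval_mul, abs_mul, pow_succ]
      exact mul_le_mul ih ((abs_eval_wtPoly_le h1 h2 _).trans hρ.le) (abs_nonneg _) (by positivity)
  | succ j ih =>
    obtain ⟨K, hK, ih⟩ := ih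
    have hd : 0 < ρ - r := sub_pos.2 hρ
    refine ⟨2 * (j + 1) * K / (ρ - r), by positivity, fun e b h1 h2 n => ?_⟩
    induction n with
    | zero =>
      simp only [wtProd, Finset.range_zero, Finset.prod_empty, Function.iterate_succ_apply,
        Polynomial.derivative_one, Polynomial.iterate_derivative_zero, Polynomial.eval_zero,
        abs_zero]
      positivity
    | succ n ihn =>
      rw [wtProd_succ, eval_iterate_derivative_mul_affine (derivative_wtPoly _)]
      refine (abs_add_le _ _).trans ?_
      rw [abs_mul, abs_mul, abs_mul]
      have e1 : |((if e n = 1 then -2 else 1 : ℝ))| ≤ 2 := by split_ifs <;> norm_num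
      have e2 : |((j : ℝ) + 1)| = j + 1 := abs_of_nonneg (by positivity)
      rw [e2]
      calc _ ≤ (2 * (j + 1) * K / (ρ - r) * ρ ^ n) * r + (j + 1) * (K * ρ ^ n) * 2 := by
            gcongr
            · exact abs_eval_wtPoly_le h1 h2 _
            · exact ih e b h1 h2 n
        _ = _ := by field_simp; ring

lemma exists_bound_termPoly {r ρ : ℝ} (hr : 0 ≤ r) (hr1 : r ≤ 1) (hρ : r < ρ) (j : ℕ) :
    ∃ K : ℝ, 0 ≤ K ∧ ∀ (e : ℕ → ℕ) (b : ℝ), |b| ≤ r → |1 - 2 * b| ≤ r → ∀ n,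
      |(derivative^[j] (termPoly e n)).eval b| ≤ K * ρ ^ n := by
  have hρ0 : 0 < ρ := hr.trans_lt hρ
  cases j with
  | zero =>
    obtain ⟨K, hK, H⟩ := exists_bound_wtProd hr hρ 0
    refine ⟨K * 2, by positivity, fun e b h1 h2 n => ?_⟩
    have := H e b h1 h2 n
    simp only [Function.iterate_zero, id_eq, termPoly, Polynomial.eval_mul, abs_mul] at this ⊢
    calc _ ≤ (K * ρ ^ n) * 2 := by
          gcongr
          exact abs_eval_qPoly_le (h1.trans hr1) _
      _ = _ := by ring
  | succ j =>
    obtain ⟨K, hK, H⟩ := exists_bound_wtProd hr hρ (j + 1)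
    obtain ⟨L, hL, H'⟩ := exists_bound_wtProd hr hρ j
    refine ⟨K * 2 + (j + 1) * L, by positivity, fun e b h1 h2 n => ?_⟩
    rw [termPoly, eval_iterate_derivative_mul_affine (derivative_qPoly _)]
    refine (abs_add_le _ _).trans ?_
    rw [abs_mul, abs_mul, abs_mul]
    have e1 : |((if e n = 0 then 0 else if e n = 1 then 1 else -1 : ℝ))| ≤ 1 := by
      split_ifs <;> norm_num
    have e2 : |((j : ℝ) + 1)| = j + 1 := abs_of_nonneg (by positivity)
    rw [e2]
    calc _ ≤ (K * ρ ^ n) * 2 + (j + 1) * (L * ρ ^ n) * 1 := by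
          gcongr
          · exact H e b h1 h2 n
          · exact abs_eval_qPoly_le (h1.trans hr1) _
          · exact H' e b h1 h2 n
      _ = _ := by ring

lemma eval_termPoly_tDigit (b x : ℝ) (n : ℕ) :
    (termPoly (tDigit x) n).eval b =
      b ^ (n - lCount x n) * (1 - 2 * b) ^ lCount x n * qDig b (tDigit x n) := by
  have h : (wtProd (tDigit x) n).eval b =
      b ^ (n - lCount x n) * (1 - 2 * b) ^ lCount x n := by
    unfold wtProd wtPoly lCount
    rw [Polynomial.eval_prod]
    simp only [apply_ite (Polynomial.eval b)]
    rw [Finset.prod_ite, Finset.prod_const, Finset.prod_const]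
    have := Finset.card_filter_add_card_filter_not (s := Finset.range n)
      (fun i => tDigit x i = 1)
    rw [Finset.card_range] at this
    rw [show (Finset.filter (fun i => ¬ tDigit x i = 1) (Finset.range n)).card
      = n - (Finset.filter (fun i => tDigit x i = 1) (Finset.range n)).card by omega]
    simp [mul_comm]
  rw [termPoly, Polynomial.eval_mul, h]
  congr 1
  unfold qPoly qDig
  split_ifs <;> simp

lemma Okamoto_eq_tsum (b x : ℝ) : Okamoto b x = ∑' n, (termPoly (tDigit x) n).eval b := by
  simp only [Okamoto, eval_termPoly_tDigit]

/-- The interval of parameters around `a` on which all series are controlled uniformly. -/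
def paramNhd (a : ℝ) : Set ℝ := Ioo (a / 2) (5 / 6)

lemma exists_rate {a : ℝ} (ha : 0 < a) : ∃ r : ℝ, 0 ≤ r ∧ r < 1 ∧
    ∀ b ∈ paramNhd a, |b| ≤ r ∧ |1 - 2 * b| ≤ r := by
  refine ⟨max (5 / 6) (1 - a), by positivity, max_lt (by norm_num) (by linarith), ?_⟩
  rintro b ⟨h1, h2⟩
  have h3 := le_max_left (5 / 6) (1 - a)
  have h4 := le_max_right (5 / 6) (1 - a)
  exact ⟨abs_le.2 ⟨by linarith, by linarith⟩, abs_le.2 ⟨by linarith, by linarith⟩⟩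

lemma mem_paramNhd {a : ℝ} (ha : 0 < a) (ha' : a < 2 / 3) : a ∈ paramNhd a :=
  ⟨by linarith, by linarith⟩

lemma exists_summable_bound {a : ℝ} (ha : 0 < a) (j : ℕ) :
    ∃ u : ℕ → ℝ, Summable u ∧ ∀ (e : ℕ → ℕ), ∀ b ∈ paramNhd a, ∀ n,
      ‖(derivative^[j] (termPoly e n)).eval b‖ ≤ u n := by
  obtain ⟨r, hr, hr1, H⟩ := exists_rate ha
  obtain ⟨K, -, hK⟩ := exists_bound_termPoly (ρ := (1 + r) / 2) hr hr1.le (by linarith) j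
  refine ⟨fun n => K * ((1 + r) / 2) ^ n,
    (summable_geometric_of_lt_one (by linarith) (by linarith)).mul_left K, fun e b hb n => ?_⟩
  exact hK e b (H b hb).1 (H b hb).2 n

lemma summable_termPoly {a b : ℝ} (ha : 0 < a) (hb : b ∈ paramNhd a) (j : ℕ) (e : ℕ → ℕ) :
    Summable fun n => (derivative^[j] (termPoly e n)).eval b := by
  obtain ⟨u, hu, H⟩ := exists_summable_bound ha j
  exact .of_norm_bounded hu fun n => H e b hb n

lemma hasDerivAt_tsum_termPoly {a b : ℝ} (ha : 0 < a) (hb : b ∈ paramNhd a) (j : ℕ)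
    (e : ℕ → ℕ) :
    HasDerivAt (fun z => ∑' n, (derivative^[j] (termPoly e n)).eval z)
      (∑' n, (derivative^[j + 1] (termPoly e n)).eval b) b := by
  obtain ⟨u, hu, H⟩ := exists_summable_bound ha (j + 1)
  refine hasDerivAt_tsum_of_isPreconnected hu isOpen_Ioo isPreconnected_Ioo
    (fun n y _ => ?_) (fun n y hy => H e y hy n) hb (summable_termPoly ha hb j e) hb
  rw [Function.iterate_succ_apply']
  exact Polynomial.hasDerivAt _ _

lemma iteratedDeriv_Okamoto {a b : ℝ} (ha : 0 < a) (hb : b ∈ paramNhd a) (j : ℕ) (x : ℝ) :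
    iteratedDeriv j (fun z => Okamoto z x) b =
      ∑' n, (derivative^[j] (termPoly (tDigit x) n)).eval b := by
  induction j generalizing b with
  | zero => simp [Okamoto_eq_tsum]
  | succ j ih =>
    rw [iteratedDeriv_succ]
    refine (Filter.EventuallyEq.deriv_eq ?_).trans
      (hasDerivAt_tsum_termPoly ha hb j (tDigit x)).deriv
    filter_upwards [isOpen_Ioo.mem_nhds hb] with z hz using ih hz

lemma contDiffAt_Okamoto {a : ℝ} (ha : 0 < a) (ha' : a < 2 / 3) (n : ℕ) (x : ℝ) :
    ContDiffAt ℝ n (fun z => Okamoto z x) a := by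
  refine ContDiffOn.contDiffAt (s := paramNhd a) ?_
    (isOpen_Ioo.mem_nhds (mem_paramNhd ha ha'))
  refine contDiffOn_of_differentiableOn_deriv fun m _ => ?_
  intro b hb
  have h1 : HasDerivAt (iteratedDeriv m fun z => Okamoto z x) _ b :=
    (hasDerivAt_tsum_termPoly ha hb m (tDigit x)).congr_of_eventuallyEq (by
      filter_upwards [isOpen_Ioo.mem_nhds hb] with z hz using iteratedDeriv_Okamoto ha hz m x)
  refine (h1.differentiableAt.differentiableWithinAt).congr (fun y hy => ?_) ?_
  · exact iteratedDerivWithin_of_isOpen isOpen_Ioo hy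
  · exact iteratedDerivWithin_of_isOpen isOpen_Ioo hb

lemma exists_bound_Mfun {a : ℝ} (ha : 0 < a) (ha' : a < 2 / 3) (k : ℕ) :
    ∃ B : ℝ, 0 ≤ B ∧ ∀ x, |Mfun k a x| ≤ B := by
  obtain ⟨u, hu, H⟩ := exists_summable_bound ha k
  have hu0 : ∀ n, 0 ≤ u n := fun n =>
    (norm_nonneg _).trans (H (fun _ => 0) a (mem_paramNhd ha ha') n)
  refine ⟨∑' n, u n, tsum_nonneg hu0, fun x => ?_⟩
  rw [Mfun, iteratedDeriv_Okamoto ha (mem_paramNhd ha ha')]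
  exact tsum_of_norm_bounded hu.hasSum fun n => H _ a (mem_paramNhd ha ha') n

lemma tDigit_of_ne_one {x : ℝ} (hx : x ≠ 1) (n : ℕ) :
    tDigit x n = (⌊(3 : ℝ) ^ (n + 1) * x⌋ - 3 * ⌊(3 : ℝ) ^ n * x⌋).toNat := if_neg hx

lemma tDigit_div_three_zero {d : ℕ} (hd : d < 3) {y : ℝ} (hy0 : 0 ≤ y) (hy1 : y < 1) :
    tDigit ((d + y) / 3) 0 = d := by
  have hd' : (d : ℝ) ≤ 2 := by exact_mod_cast Nat.le_of_lt_succ hd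
  rw [tDigit_of_ne_one (by intro h; linarith)]
  have h1 : ⌊(3 : ℝ) ^ (0 + 1) * ((d + y) / 3)⌋ = d := by
    rw [Int.floor_eq_iff]; push_cast; constructor <;> linarith
  have h2 : ⌊(3 : ℝ) ^ 0 * ((d + y) / 3)⌋ = 0 := by
    have : (0 : ℝ) ≤ d := Nat.cast_nonneg d
    rw [Int.floor_eq_iff]; push_cast; constructor <;> linarith
  rw [h1, h2]
  simp

lemma tDigit_div_three_succ {d : ℕ} (hd : d < 3) {y : ℝ} (hy1 : y < 1) (n : ℕ) :
    tDigit ((d + y) / 3) (n + 1) = tDigit y n := by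
  have hd' : (d : ℝ) ≤ 2 := by exact_mod_cast Nat.le_of_lt_succ hd
  rw [tDigit_of_ne_one (by intro h; linarith), tDigit_of_ne_one hy1.ne]
  have key : ∀ m : ℕ, ⌊(3 : ℝ) ^ (m + 1) * ((d + y) / 3)⌋ = 3 ^ m * d + ⌊(3 : ℝ) ^ m * y⌋ := by
    intro m
    have : (3 : ℝ) ^ (m + 1) * ((d + y) / 3) = ((3 ^ m * d : ℤ) : ℝ) + (3 : ℝ) ^ m * y := by
      push_cast; ring
    rw [this, Int.floor_intCast_add]
  rw [key, key]
  congr 1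
  ring

lemma termPoly_zero (e : ℕ → ℕ) : termPoly e 0 = qPoly (e 0) := by
  simp [termPoly, wtProd]

lemma termPoly_succ (e : ℕ → ℕ) (n : ℕ) :
    termPoly e (n + 1) = wtPoly (e 0) * termPoly (fun i => e (i + 1)) n := by
  rw [termPoly, termPoly, wtProd, Finset.prod_range_succ', wtProd]
  ring

lemma Okamoto_div_three_of_lt {a b : ℝ} (ha : 0 < a) (hb : b ∈ paramNhd a) {d : ℕ} (hd : d < 3)
    {y : ℝ} (hy0 : 0 ≤ y) (hy1 : y < 1) :
    Okamoto b ((d + y) / 3) = (qPoly d).eval b + (wtPoly d).eval b * Okamoto b y := by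
  have hs := summable_termPoly ha hb 0 (tDigit ((d + y) / 3))
  simp only [Function.iterate_zero, id_eq] at hs
  rw [Okamoto_eq_tsum, Okamoto_eq_tsum, hs.tsum_eq_zero_add, termPoly_zero,
    tDigit_div_three_zero hd hy0 hy1, ← tsum_mul_left]
  simp only [termPoly_succ, tDigit_div_three_zero hd hy0 hy1, tDigit_div_three_succ hd hy1,
    Polynomial.eval_mul]

lemma Okamoto_zero (b : ℝ) : Okamoto b 0 = 0 := by
  have : ∀ n, tDigit 0 n = 0 := fun n => by simp [tDigit]
  simp [Okamoto, this, qDig]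

lemma Okamoto_one {a b : ℝ} (ha : 0 < a) (hb : b ∈ paramNhd a) : Okamoto b 1 = 1 := by
  have h1 : ∀ n, tDigit 1 n = 2 := fun n => by simp [tDigit]
  obtain ⟨hb1, hb2⟩ := hb
  have hl : ∀ n, lCount 1 n = 0 := fun n => by simp [lCount, h1]
  simp only [Okamoto, h1, hl, qDig]
  simp only [tsub_zero, pow_zero, mul_one, OfNat.ofNat_ne_zero, if_false, OfNat.ofNat_ne_one]
  rw [tsum_mul_right, tsum_geometric_of_lt_one (by linarith) (by linarith)]
  exact inv_mul_cancel₀ (by linarith)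

/-- The functional equation of Okamoto's function. -/
lemma Okamoto_div_three {a b : ℝ} (ha : 0 < a) (hb : b ∈ paramNhd a) {d : ℕ} (hd : d < 3)
    {y : ℝ} (hy0 : 0 ≤ y) (hy1 : y ≤ 1) :
    Okamoto b ((d + y) / 3) = (qPoly d).eval b + (wtPoly d).eval b * Okamoto b y := by
  rcases hy1.lt_or_eq with hy | rfl
  · exact Okamoto_div_three_of_lt ha hb hd hy0 hy
  · rw [Okamoto_one ha hb]
    interval_cases d
    · have := Okamoto_div_three_of_lt ha hb (d := 1) (by norm_num) le_rfl zero_lt_one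
      rw [Okamoto_zero] at this
      norm_num [qPoly, wtPoly] at this ⊢
      exact this
    · have := Okamoto_div_three_of_lt ha hb (d := 2) (by norm_num) le_rfl zero_lt_one
      rw [Okamoto_zero] at this
      norm_num [qPoly, wtPoly] at this ⊢
      rw [this]
      ring
    · norm_num [qPoly, wtPoly, Okamoto_one ha hb]

/-- The increment of `F_b` over the triadic interval `[p / 3 ^ N, (p + 1) / 3 ^ N]`, as a
polynomial in `b`. -/
noncomputable def incPoly : ℕ → ℕ → ℝ[X]
  | 0, _ => 1
  | N + 1, p => incPoly N (p / 3) * wtPoly (p % 3)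

lemma incPoly_add (N m p D : ℕ) (hD : D < 3 ^ m) :
    incPoly (N + m) (3 ^ m * p + D) = incPoly N p * incPoly m D := by
  induction m generalizing D with
  | zero =>
    obtain rfl : D = 0 := by simpa using hD
    simp [incPoly]
  | succ m ih =>
    rw [← add_assoc, incPoly, incPoly]
    have h1 : (3 ^ (m + 1) * p + D) / 3 = 3 ^ m * p + D / 3 := by
      rw [pow_succ', mul_assoc, Nat.mul_add_div (by norm_num)]
    have h2 : (3 ^ (m + 1) * p + D) % 3 = D % 3 := by
      rw [pow_succ', mul_assoc, Nat.mul_add_mod]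
    rw [h1, h2, ih _ (by rw [pow_succ] at hD; omega), mul_assoc]

/-- On each triadic interval, `F_b` is an affine copy of itself. -/
lemma Okamoto_triadic {a b : ℝ} (ha : 0 < a) (hb : b ∈ paramNhd a) (N p : ℕ) (hp : p < 3 ^ N)
    {y : ℝ} (hy0 : 0 ≤ y) (hy1 : y ≤ 1) :
    Okamoto b ((p + y) / 3 ^ N) = Okamoto b (p / 3 ^ N) + (incPoly N p).eval b * Okamoto b y := by
  induction N generalizing p y with
  | zero =>
    obtain rfl : p = 0 := by simpa using hp
    simp [incPoly, Okamoto_zero]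
  | succ N ih =>
    have hp3 : p / 3 < 3 ^ N := by rw [pow_succ] at hp; omega
    have hd : p % 3 < 3 := Nat.mod_lt _ (by norm_num)
    have hpd : (p : ℝ) = 3 * (p / 3 : ℕ) + (p % 3 : ℕ) := by
      exact_mod_cast (Nat.div_add_mod p 3).symm
    have hd2 : ((p % 3 : ℕ) : ℝ) ≤ 2 := by exact_mod_cast Nat.le_of_lt_succ hd
    have hd0 : (0 : ℝ) ≤ ((p % 3 : ℕ) : ℝ) := Nat.cast_nonneg _
    have key : ∀ z : ℝ, 0 ≤ z → z ≤ 1 → Okamoto b ((p + z) / 3 ^ (N + 1)) =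
        Okamoto b ((p / 3 : ℕ) / 3 ^ N) + (incPoly N (p / 3)).eval b *
          ((qPoly (p % 3)).eval b + (wtPoly (p % 3)).eval b * Okamoto b z) := by
      intro z hz0 hz1
      rw [← Okamoto_div_three ha hb hd hz0 hz1, ← ih (p / 3) hp3 (by positivity) (by linarith)]
      congr 1
      rw [hpd, pow_succ]
      field_simp
      ring
    have h0 := key 0 le_rfl zero_le_one
    rw [add_zero, Okamoto_zero] at h0
    rw [key y hy0 hy1, h0, incPoly, Polynomial.eval_mul]
    ring

lemma iteratedDeriv_polynomial_eval (P : ℝ[X]) (j : ℕ) (b : ℝ) :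
    iteratedDeriv j (fun z => P.eval z) b = (derivative^[j] P).eval b := by
  induction j generalizing b with
  | zero => simp
  | succ j ih =>
    rw [iteratedDeriv_succ, Function.iterate_succ_apply', funext ih, Polynomial.deriv]

/-- The increment of `M_{j,a}` over the triadic interval `[p / 3 ^ N, (p + 1) / 3 ^ N]`. -/
noncomputable def inc (a : ℝ) (j N p : ℕ) : ℝ := (derivative^[j] (incPoly N p)).eval a

lemma Mfun_triadic {a : ℝ} (ha : 0 < a) (ha' : a < 2 / 3) (k N p : ℕ) (hp : p < 3 ^ N)
    {y : ℝ} (hy0 : 0 ≤ y) (hy1 : y ≤ 1) :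
    Mfun k a ((p + y) / 3 ^ N) = Mfun k a (p / 3 ^ N) +
      ∑ i ∈ Finset.range (k + 1), k.choose i * inc a i N p * Mfun (k - i) a y := by
  have hpoly : ContDiffAt ℝ k (fun b => (incPoly N p).eval b) a :=
    by
    simpa using ((incPoly N p).contDiff_aeval k (𝕜 := ℝ)).contDiffAt (x := a)
  have hO := fun x => contDiffAt_Okamoto ha ha' k x
  have h : (fun b => Okamoto b ((p + y) / 3 ^ N)) =ᶠ[𝓝 a]
      fun b => Okamoto b (p / 3 ^ N) + (incPoly N p).eval b * Okamoto b y := by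
    filter_upwards [isOpen_Ioo.mem_nhds (mem_paramNhd ha ha')] with b hb
      using Okamoto_triadic ha hb N p hp hy0 hy1
  rw [Mfun, h.iteratedDeriv_eq, iteratedDeriv_fun_add (hO _) (hpoly.mul (hO y)),
    iteratedDeriv_fun_mul hpoly (hO y)]
  simp only [iteratedDeriv_polynomial_eval, Mfun, inc]

lemma Mfun_one {a : ℝ} (ha : 0 < a) (ha' : a < 2 / 3) (k : ℕ) :
    Mfun k a 1 = if k = 0 then 1 else 0 := by
  have h : (fun b => Okamoto b 1) =ᶠ[𝓝 a] fun _ => 1 := by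
    filter_upwards [isOpen_Ioo.mem_nhds (mem_paramNhd ha ha')] with b hb
      using Okamoto_one ha hb
  rw [Mfun, h.iteratedDeriv_eq, iteratedDeriv_const]

lemma Mfun_triadic_succ {a : ℝ} (ha : 0 < a) (ha' : a < 2 / 3) (k N p : ℕ) (hp : p < 3 ^ N) :
    Mfun k a ((p + 1) / 3 ^ N) = Mfun k a (p / 3 ^ N) + inc a k N p := by
  rw [Mfun_triadic ha ha' k N p hp zero_le_one le_rfl, Finset.sum_range_succ,
    Finset.sum_eq_zero]
  · simp [Mfun_one ha ha']
  · intro i hi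
    rw [Mfun_one ha ha', if_neg (by have := Finset.mem_range.1 hi; omega), mul_zero]

/-- The oscillation of `M_{k,a}` on a triadic interval is controlled by the increments of
`M_{0,a}, …, M_{k,a}` over it. -/
lemma exists_oscillation_bound {a : ℝ} (ha : 0 < a) (ha' : a < 2 / 3) (k : ℕ) :
    ∃ A : ℝ, 0 < A ∧ ∀ (N p : ℕ), p < 3 ^ N → ∀ η : ℝ,
      (∀ i ≤ k, |inc a i N p| ≤ η) → ∀ x y : ℝ, p ≤ 3 ^ N * x → 3 ^ N * x ≤ p + 1 →
      p ≤ 3 ^ N * y → 3 ^ N * y ≤ p + 1 → |Mfun k a y - Mfun k a x| ≤ A * η := by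
  choose B hB0 hB using fun i => exists_bound_Mfun ha ha' i
  refine ⟨1 + ∑ i ∈ Finset.range (k + 1), 2 * (k.choose i * B (k - i)), ?_, ?_⟩
  · have : 0 ≤ ∑ i ∈ Finset.range (k + 1), 2 * (k.choose i * B (k - i)) :=
      Finset.sum_nonneg fun i _ => by have := hB0 (k - i); positivity
    linarith
  intro N p hp η hinc x y hx1 hx2 hy1 hy2
  have hη : 0 ≤ η := (abs_nonneg _).trans (hinc 0 (Nat.zero_le _))
  have key : ∀ z : ℝ, Mfun k a z = Mfun k a ((p + (3 ^ N * z - p)) / 3 ^ N) := fun z => by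
    congr 1; field_simp; ring
  rw [key x, key y, Mfun_triadic ha ha' k N p hp (by linarith) (by linarith),
    Mfun_triadic ha ha' k N p hp (by linarith) (by linarith), add_sub_add_left_eq_sub,
    ← Finset.sum_sub_distrib]
  refine (Finset.abs_sum_le_sum_abs _ _).trans ?_
  calc _ ≤ ∑ i ∈ Finset.range (k + 1), (2 * (k.choose i * B (k - i))) * η := by
        refine Finset.sum_le_sum fun i hi => ?_
        have hi' : i ≤ k := Nat.lt_succ_iff.1 (Finset.mem_range.1 hi)
        rw [← mul_sub, abs_mul, abs_mul, Nat.abs_cast]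
        have h1 := hB (k - i) (3 ^ N * y - p)
        have h2 := hB (k - i) (3 ^ N * x - p)
        calc _ ≤ (k.choose i : ℝ) * η * (B (k - i) + B (k - i)) := by
              gcongr
              · exact hinc i hi'
              · exact (abs_sub _ _).trans (add_le_add h1 h2)
          _ = _ := by ring
    _ = (∑ i ∈ Finset.range (k + 1), 2 * (k.choose i * B (k - i))) * η := by
        rw [Finset.sum_mul]
    _ ≤ _ := by nlinarith

lemma hasDerivAt_zero_of_geometric {f : ℝ → ℝ} {x s : ℝ} (hs0 : 0 < s) (hs1 : s < 1)
    (H : ∀ ε > 0, ∃ N₀ : ℕ, ∀ N ≥ N₀, ∀ y, |y - x| ≤ s ^ (N + 1) → |f y - f x| ≤ ε * s ^ N) :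
    HasDerivAt f 0 x := by
  rw [hasDerivAt_iff_isLittleO, Asymptotics.isLittleO_iff]
  intro c hc
  obtain ⟨N₀, hN₀⟩ := H (c * s ^ 2) (by positivity)
  filter_upwards [Metric.ball_mem_nhds x (pow_pos hs0 (N₀ + 1))] with y hy
  rw [Metric.mem_ball, Real.dist_eq] at hy
  simp only [smul_zero, sub_zero, Real.norm_eq_abs]
  rcases eq_or_ne y x with rfl | hne
  · simp
  have hpos : 0 < |y - x| := abs_pos.2 (sub_ne_zero.2 hne)
  obtain ⟨n, hn1, hn2⟩ := exists_nat_pow_near_of_lt_one hpos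
    (hy.le.trans (pow_le_one₀ hs0.le hs1.le)) hs0 hs1
  have hn : N₀ + 1 ≤ n := by
    by_contra! h
    have := pow_le_pow_of_le_one hs0.le hs1.le (show n + 1 ≤ N₀ + 1 by omega)
    linarith
  obtain ⟨m, rfl⟩ : ∃ m, n = m + 1 := ⟨n - 1, by omega⟩
  calc _ ≤ c * s ^ 2 * s ^ m := hN₀ m (by omega) y hn2
    _ = c * s ^ (m + 1 + 1) := by ring
    _ ≤ _ := by gcongr

/-- The increments of `M_{j,a}` over the triadic intervals of generation `N` at distance
`O(3 ^ (-N))` from `x` are `o(3 ^ (-N))`. -/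
def SmallInc (a : ℝ) (j : ℕ) (x : ℝ) : Prop :=
  ∀ K > 0, ∀ ε > 0, ∃ N₀ : ℕ, ∀ N ≥ N₀, ∀ p : ℕ, p < 3 ^ N → |(p : ℝ) - 3 ^ N * x| ≤ K →
    3 ^ N * |inc a j N p| ≤ ε

lemma exists_forall_div_three_pow_lt (K : ℝ) {δ : ℝ} (hδ : 0 < δ) :
    ∃ N₀ : ℕ, ∀ N ≥ N₀, K / (3 : ℝ) ^ N < δ := by
  have h : Tendsto (fun N : ℕ => K / (3 : ℝ) ^ N) atTop (𝓝 0) :=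
    tendsto_const_nhds.div_atTop (tendsto_pow_atTop_atTop_of_one_lt (by norm_num))
  simpa [eventually_atTop] using h.eventually (gt_mem_nhds hδ)

lemma HasDerivAt.exists_inc_le {a : ℝ} (ha : 0 < a) (ha' : a < 2 / 3) {k : ℕ} {d x : ℝ}
    (h : HasDerivAt (Mfun k a) d x) (K : ℝ) {ε : ℝ} (hε : 0 < ε) :
    ∃ N₀ : ℕ, ∀ N ≥ N₀, ∀ p : ℕ, p < 3 ^ N → |(p : ℝ) - 3 ^ N * x| ≤ K →
      3 ^ N * |inc a k N p| ≤ (|d| + ε) * (2 * K + 1) := by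
  rw [hasDerivAt_iff_isLittleO, Asymptotics.isLittleO_iff] at h
  obtain ⟨δ, hδ, H⟩ := Metric.eventually_nhds_iff.1 (h hε)
  obtain ⟨N₀, hN₀⟩ := exists_forall_div_three_pow_lt (K + 1) hδ
  refine ⟨N₀, fun N hN p hp hpx => ?_⟩
  have h3 : (0 : ℝ) < 3 ^ N := by positivity
  have key : ∀ z : ℝ, |z - 3 ^ N * x| ≤ K + 1 →
      3 ^ N * |Mfun k a (z / 3 ^ N) - Mfun k a x| ≤ (|d| + ε) * |z - 3 ^ N * x| := by
    intro z hz
    have hd : z / 3 ^ N - x = (z - 3 ^ N * x) / 3 ^ N := by field_simp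
    have hd' : |z / 3 ^ N - x| = |z - 3 ^ N * x| / 3 ^ N := by
      rw [hd, abs_div, abs_of_pos h3]
    have hlt : dist (z / 3 ^ N) x < δ := by
      rw [Real.dist_eq, hd']
      exact (div_le_div_of_nonneg_right hz h3.le).trans_lt (hN₀ N hN)
    have h1 := H hlt
    rw [Real.norm_eq_abs, Real.norm_eq_abs, smul_eq_mul] at h1
    have h2 : |Mfun k a (z / 3 ^ N) - Mfun k a x| ≤ (|d| + ε) * |z / 3 ^ N - x| := by
      calc _ = |(Mfun k a (z / 3 ^ N) - Mfun k a x - (z / 3 ^ N - x) * d)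
              + (z / 3 ^ N - x) * d| := by ring_nf
        _ ≤ ε * |z / 3 ^ N - x| + |z / 3 ^ N - x| * |d| :=
            (abs_add_le _ _).trans (add_le_add h1 (abs_mul _ _).le)
        _ = _ := by ring
    rw [hd'] at h2
    calc _ ≤ 3 ^ N * ((|d| + ε) * (|z - 3 ^ N * x| / 3 ^ N)) := by gcongr
      _ = _ := by field_simp
  have h1 := key p (by linarith)
  have h4 : |(p + 1 : ℝ) - 3 ^ N * x| ≤ K + 1 := by
    rw [abs_le] at hpx ⊢; constructor <;> linarith
  have h2 := key (p + 1) h4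
  have h5 : inc a k N p = (Mfun k a ((p + 1) / 3 ^ N) - Mfun k a x)
      - (Mfun k a (p / 3 ^ N) - Mfun k a x) := by
    rw [Mfun_triadic_succ ha ha' k N p hp]; ring
  have hdε : 0 ≤ |d| + ε := by positivity
  calc _ ≤ 3 ^ N * (|Mfun k a ((p + 1) / 3 ^ N) - Mfun k a x|
          + |Mfun k a (p / 3 ^ N) - Mfun k a x|) := by
        rw [h5]; gcongr; exact abs_sub _ _
    _ ≤ (|d| + ε) * (K + 1) + (|d| + ε) * K := by
        rw [mul_add]
        exact add_le_add (h2.trans (by gcongr)) (h1.trans (by gcongr))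
    _ = _ := by ring

lemma HasDerivAt.smallInc {a : ℝ} (ha : 0 < a) (ha' : a < 2 / 3) {k : ℕ} {x : ℝ}
    (h : HasDerivAt (Mfun k a) 0 x) : SmallInc a k x := by
  intro K hK ε hε
  obtain ⟨N₀, H⟩ := h.exists_inc_le ha ha' K (ε := ε / (2 * K + 1)) (by positivity)
  refine ⟨N₀, fun N hN p hp hpx => (H N hN p hp hpx).trans_eq ?_⟩
  rw [abs_zero, zero_add]
  field_simp

lemma SmallInc.of_succ {a : ℝ} {j : ℕ} {x : ℝ} (h : SmallInc a (j + 1) x) :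
    SmallInc a j x := by
  intro K hK ε hε
  obtain ⟨N₁, H₁⟩ := h K hK (ε / (3 * (1 + |a|))) (by positivity)
  obtain ⟨N₂, H₂⟩ := h (3 * K) (by positivity) ε hε
  refine ⟨max N₁ N₂, fun N hN p hp hpx => ?_⟩
  have h1 := H₁ N (le_of_max_le_left hN) p hp hpx
  have h2 := H₂ (N + 1) (by have := le_of_max_le_right hN; omega) (3 * p)
    (by rw [pow_succ]; omega) (by
      have : ((3 * p : ℕ) : ℝ) - 3 ^ (N + 1) * x = 3 * (p - 3 ^ N * x) := by push_cast; ring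
      rw [this, abs_mul, abs_of_pos (by norm_num : (0 : ℝ) < 3)]
      gcongr)
  have h3 : inc a (j + 1) (N + 1) (3 * p) = inc a (j + 1) N p * a + (j + 1) * inc a j N p := by
    have : incPoly (N + 1) (3 * p) = incPoly N p * X := by
      simp [incPoly, wtPoly]
    rw [inc, this, eval_iterate_derivative_mul_affine (c := 1) (by simp)]
    simp [inc]
  have h4 : |inc a j N p| ≤ |inc a (j + 1) (N + 1) (3 * p)| + |inc a (j + 1) N p| * |a| := by
    calc |inc a j N p| ≤ |(j + 1) * inc a j N p| := by
          rw [abs_mul]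
          refine le_mul_of_one_le_left (abs_nonneg _) ?_
          rw [abs_of_nonneg (by positivity)]
          linarith [(Nat.cast_nonneg j : (0 : ℝ) ≤ j)]
      _ = |inc a (j + 1) (N + 1) (3 * p) - inc a (j + 1) N p * a| := by rw [h3]; ring_nf
      _ ≤ _ := (abs_sub _ _).trans_eq (by rw [abs_mul])
  rw [pow_succ] at h2
  have h5 : 3 ^ N * |inc a (j + 1) N p| * |a| ≤ ε / 3 := by
    calc _ ≤ ε / (3 * (1 + |a|)) * |a| := by gcongr
      _ ≤ ε / (3 * (1 + |a|)) * (1 + |a|) := by gcongr; linarith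
      _ = _ := by field_simp
  have h6 : 3 ^ N * |inc a j N p| ≤ 3 ^ N * |inc a (j + 1) (N + 1) (3 * p)|
      + 3 ^ N * |inc a (j + 1) N p| * |a| := by
    calc _ ≤ 3 ^ N * _ := mul_le_mul_of_nonneg_left h4 (by positivity)
      _ = _ := by ring
  linarith

lemma SmallInc.mono {a : ℝ} {i j : ℕ} {x : ℝ} (h : SmallInc a j x) (hij : i ≤ j) :
    SmallInc a i x := by
  induction hij with
  | refl => exact h
  | step _ ih => exact ih h.of_succ

lemma SmallInc.uniform {a : ℝ} {k : ℕ} {x : ℝ} (h : SmallInc a k x) {K : ℝ} (hK : 0 < K)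
    {ε : ℝ} (hε : 0 < ε) :
    ∃ N₀ : ℕ, ∀ N ≥ N₀, ∀ p : ℕ, p < 3 ^ N → |(p : ℝ) - 3 ^ N * x| ≤ K → ∀ i ≤ k,
      |inc a i N p| ≤ ε * (1 / 3) ^ N := by
  have H : ∀ i, ∃ N₀ : ℕ, i ≤ k → ∀ N ≥ N₀, ∀ p : ℕ, p < 3 ^ N → |(p : ℝ) - 3 ^ N * x| ≤ K →
      3 ^ N * |inc a i N p| ≤ ε := by
    intro i
    by_cases hi : i ≤ k
    · obtain ⟨N₀, H⟩ := h.mono hi K hK ε hε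
      exact ⟨N₀, fun _ => H⟩
    · exact ⟨0, fun h => absurd h hi⟩
  choose N₀ HN using H
  refine ⟨(Finset.range (k + 1)).sup N₀, fun N hN p hp hpx i hi => ?_⟩
  have := HN i hi N ((Finset.le_sup (Finset.mem_range.2 (Nat.lt_succ_iff.2 hi))).trans hN) p hp hpx
  rw [one_div, inv_pow, ← div_eq_mul_inv, le_div_iff₀ (by positivity)]
  linarith

lemma SmallInc.hasDerivAt {a : ℝ} (ha : 0 < a) (ha' : a < 2 / 3) {k : ℕ} {x : ℝ}
    (hx : x ∈ Ioo (0 : ℝ) 1) (h : SmallInc a k x) : HasDerivAt (Mfun k a) 0 x := by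
  obtain ⟨A, hA, hosc⟩ := exists_oscillation_bound ha ha' k
  refine hasDerivAt_zero_of_geometric (s := 1 / 3) (by norm_num) (by norm_num) fun ε hε => ?_
  obtain ⟨N₁, H⟩ := h.uniform (K := 2) (by norm_num) (ε := ε / (2 * A + 1)) (by positivity)
  obtain ⟨N₂, hN₂⟩ := exists_forall_div_three_pow_lt 1 (lt_min hx.1 (sub_pos.2 hx.2))
  refine ⟨max N₁ N₂, fun N hN y hy => ?_⟩
  have h3 : (0 : ℝ) < 3 ^ N := by positivity
  have hη := hN₂ N (le_of_max_le_right hN)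
  rw [lt_min_iff] at hη
  have hyx : |3 ^ N * y - 3 ^ N * x| ≤ 1 / 3 := by
    rw [← mul_sub, abs_mul, abs_of_pos h3]
    calc _ ≤ 3 ^ N * (1 / 3 : ℝ) ^ (N + 1) := by gcongr
      _ = _ := by rw [pow_succ, ← mul_assoc, ← mul_pow]; norm_num
  have hy' : |y - x| ≤ 1 / 3 ^ N := by
    refine hy.trans ?_
    rw [one_div_pow, pow_succ]
    gcongr
    linarith
  have hy01 : 0 < y ∧ y < 1 := by
    rw [abs_le] at hy'
    constructor <;> linarith
  have hfl : ∀ z : ℝ, 0 < z → z < 1 → ⌊3 ^ N * z⌋₊ < 3 ^ N ∧ (⌊3 ^ N * z⌋₊ : ℝ) ≤ 3 ^ N * z ∧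
      3 ^ N * z < ⌊3 ^ N * z⌋₊ + 1 := by
    intro z hz0 hz1
    have h0 : 0 ≤ 3 ^ N * z := by positivity
    refine ⟨?_, Nat.floor_le h0, Nat.lt_floor_add_one _⟩
    rw [Nat.floor_lt h0]
    push_cast
    nlinarith
  obtain ⟨hp, hp1, hp2⟩ := hfl x hx.1 hx.2
  obtain ⟨hq, hq1, hq2⟩ := hfl y hy01.1 hy01.2
  set p := ⌊3 ^ N * x⌋₊
  set q := ⌊3 ^ N * y⌋₊
  rw [abs_le] at hyx
  have hpI := H N (le_of_max_le_left hN) p hp (by rw [abs_le]; constructor <;> linarith)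
  have hqI := H N (le_of_max_le_left hN) q hq (by rw [abs_le]; constructor <;> linarith)
  set η := ε / (2 * A + 1) * (1 / 3) ^ N with hηdef
  have hη0 : 0 < η := by positivity
  have hc : ∀ z : ℝ, (3 : ℝ) ^ N * (z / 3 ^ N) = z := fun z => by field_simp
  have hxp := hosc N p hp η hpI x (p / 3 ^ N) hp1 hp2.le (hc p).ge (by rw [hc]; linarith)
  have hyq := hosc N q hq η hqI (q / 3 ^ N) y (hc q).ge (by rw [hc]; linarith) hq1 hq2.le
  have hpq : |Mfun k a (q / 3 ^ N) - Mfun k a (p / 3 ^ N)| ≤ η := by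
    have h1 : (q : ℝ) < p + 2 := by linarith
    have h2 : (p : ℝ) < q + 2 := by linarith
    norm_cast at h1 h2
    obtain h | h | h : q = p ∨ q = p + 1 ∨ p = q + 1 := by omega
    · rw [h]; simpa using hη0.le
    · rw [h]; push_cast
      rw [Mfun_triadic_succ ha ha' k N p hp, add_sub_cancel_left]
      exact hpI k le_rfl
    · rw [h, abs_sub_comm]; push_cast
      rw [Mfun_triadic_succ ha ha' k N q hq, add_sub_cancel_left]
      exact hqI k le_rfl
  calc |Mfun k a y - Mfun k a x| = |(Mfun k a y - Mfun k a (q / 3 ^ N))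
        + (Mfun k a (q / 3 ^ N) - Mfun k a (p / 3 ^ N))
        + (Mfun k a (p / 3 ^ N) - Mfun k a x)| := by ring_nf
    _ ≤ A * η + η + A * η := (abs_add_three _ _ _).trans (by gcongr)
    _ = ε * (1 / 3) ^ N := by rw [hηdef]; field_simp; ring

lemma HasDerivAt.Mfun_of_succ {a : ℝ} (ha : 0 < a) (ha' : a < 2 / 3) {k : ℕ} {x : ℝ}
    (hx : x ∈ Ioo (0 : ℝ) 1) (h : HasDerivAt (Mfun (k + 1) a) 0 x) :
    HasDerivAt (Mfun k a) 0 x :=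
  (h.smallInc ha ha').of_succ.hasDerivAt ha ha' hx

/-- The numerator of the left endpoint of the `B`-adic interval given by the first `j`
base-`B` digits in `e`. -/
def node {B : ℕ} (e : ℕ → Fin B) : ℕ → ℕ
  | 0 => 0
  | j + 1 => B * node e j + e j

lemma node_lt {B : ℕ} (e : ℕ → Fin B) (j : ℕ) : node e j < B ^ j := by
  induction j with
  | zero => simp [node]
  | succ j ih =>
    have h1 := (e j).isLt
    have h2 : B * (node e j + 1) ≤ B * B ^ j := Nat.mul_le_mul_left _ ih
    rw [node, pow_succ']
    linarith [h2, mul_add B (node e j) 1]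

lemma node_congr {B : ℕ} {e e' : ℕ → Fin B} {j : ℕ} (h : ∀ i < j, e i = e' i) :
    node e j = node e' j := by
  induction j with
  | zero => rfl
  | succ j ih => rw [node, node, ih fun i hi => h i (by omega), h j (by omega)]

lemma ofDigits_succ {B : ℕ} (e : ℕ → Fin B) :
    B * Real.ofDigits e = (e 0 : ℕ) + Real.ofDigits fun i => e (i + 1) := by
  have hB : (B : ℝ) ≠ 0 := by
    have := (e 0).pos
    exact_mod_cast this.ne'
  rw [Real.ofDigits_eq_sum_add_ofDigits e 1]
  simp only [Finset.sum_range_one, Real.ofDigitsTerm, zero_add, pow_one]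
  field_simp

lemma pow_mul_ofDigits {B : ℕ} (e : ℕ → Fin B) (j : ℕ) :
    (B : ℝ) ^ j * Real.ofDigits e = node e j + Real.ofDigits fun i => e (i + j) := by
  induction j with
  | zero => simp [node]
  | succ j ih =>
    have hshift : (fun i => e (i + (j + 1))) = fun i => e (i + 1 + j) :=
      funext fun i => congrArg e (by omega)
    rw [pow_succ', mul_assoc, ih, mul_add, ofDigits_succ, node, hshift]
    push_cast
    rw [zero_add]
    ring

lemma ofDigits_mem {B : ℕ} {e : ℕ → Fin B} (h : 1 ≤ (e 0 : ℕ)) (h' : (e 0 : ℕ) + 1 < B) :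
    1 ≤ B * Real.ofDigits e ∧ B * Real.ofDigits e ≤ B - 1 := by
  rw [ofDigits_succ]
  have h1 := Real.ofDigits_nonneg fun i => e (i + 1)
  have h2 := Real.ofDigits_le_one fun i => e (i + 1)
  have h3 : (1 : ℝ) ≤ (e 0 : ℕ) := by exact_mod_cast h
  have h4 : ((e 0 : ℕ) : ℝ) + 2 ≤ B := by exact_mod_cast h'
  constructor <;> linarith

/-- A point whose base-`B` digits avoid `0` and `B - 1` stays away from the endpoints of its
`B`-adic intervals. -/
lemma node_mem {B : ℕ} {e : ℕ → Fin B} (h : ∀ j, 1 ≤ (e j : ℕ)) (h' : ∀ j, (e j : ℕ) + 1 < B)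
    (j : ℕ) : node e j + (1 / B : ℝ) ≤ B ^ j * Real.ofDigits e ∧
      B ^ j * Real.ofDigits e ≤ node e j + 1 - (1 / B : ℝ) := by
  have hB : (0 : ℝ) < B := by exact_mod_cast (e 0).pos
  have := ofDigits_mem (e := fun i => e (i + j)) (h _) (h' _)
  rw [pow_mul_ofDigits]
  constructor
  · rw [add_le_add_iff_left, div_le_iff₀ hB]; linarith
  · rw [add_sub_assoc, add_le_add_iff_left, ← mul_le_mul_iff_right₀ hB, mul_sub,
      mul_one_div_cancel hB.ne', mul_one]
    exact this.2

lemma one_le_mul_abs_sub_of_node_ne {B : ℕ} {e e' : ℕ → Fin B}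
    (h : ∀ j, 1 ≤ (e j : ℕ)) (h' : ∀ j, (e j : ℕ) + 1 < B)
    (k : ∀ j, 1 ≤ (e' j : ℕ)) (k' : ∀ j, (e' j : ℕ) + 1 < B) {j : ℕ}
    (hne : node e j ≠ node e' j) :
    1 ≤ (B : ℝ) ^ (j + 1) * |Real.ofDigits e - Real.ofDigits e'| := by
  have hB : (0 : ℝ) < B := by exact_mod_cast (e 0).pos
  have h1 := node_mem h h' j
  have h2 := node_mem k k' j
  have h0 : (0 : ℝ) < 1 / B := by positivity
  have key : 1 / (B : ℝ) ≤ |B ^ j * Real.ofDigits e - B ^ j * Real.ofDigits e'| := by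
    rcases lt_or_gt_of_ne hne with hlt | hlt
    · have : (node e j : ℝ) + 1 ≤ node e' j := by exact_mod_cast hlt
      rw [abs_sub_comm]
      exact le_trans (by linarith) (le_abs_self _)
    · have : (node e' j : ℝ) + 1 ≤ node e j := by exact_mod_cast hlt
      exact le_trans (by linarith) (le_abs_self _)
  rw [← mul_sub, abs_mul, abs_of_nonneg (by positivity), div_le_iff₀ hB] at key
  calc _ ≤ _ := key
    _ = _ := by ring

lemma incPoly_node {m : ℕ} (e : ℕ → Fin (3 ^ m)) (j : ℕ) :
    incPoly (m * j) (node e j) = ∏ i ∈ Finset.range j, incPoly m (e i) := by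
  induction j with
  | zero => simp [incPoly, node]
  | succ j ih =>
    rw [mul_add, mul_one, node, incPoly_add _ _ _ _ (e j).isLt, ih, Finset.prod_range_succ]

lemma hasDerivAt_zero_of_blocks {a : ℝ} (ha : 0 < a) (ha' : a < 2 / 3) {k m : ℕ} (hm : 1 ≤ m)
    {e : ℕ → Fin (3 ^ m)} (h : ∀ j, 1 ≤ (e j : ℕ)) (h' : ∀ j, (e j : ℕ) + 1 < 3 ^ m)
    (hsmall : ∀ i ≤ k,
      Tendsto (fun j => 3 ^ (m * j) * |inc a i (m * j) (node e j)|) atTop (𝓝 0)) :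
    HasDerivAt (Mfun k a) 0 (Real.ofDigits e) := by
  obtain ⟨A, hA, hosc⟩ := exists_oscillation_bound ha ha' k
  have hB : (0 : ℝ) < 3 ^ m := by positivity
  refine hasDerivAt_zero_of_geometric (s := 1 / 3 ^ m) (by positivity) ?_ fun ε hε => ?_
  · rw [div_lt_one hB]
    exact one_lt_pow₀ (by norm_num) (by omega)
  have hev : ∀ᶠ j in atTop, ∀ i ∈ Finset.range (k + 1),
      3 ^ (m * j) * |inc a i (m * j) (node e j)| < ε / A :=
    (Filter.eventually_all_finset _).2 fun i hi =>
      (hsmall i (Nat.lt_succ_iff.1 (Finset.mem_range.1 hi))).eventually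
        (gt_mem_nhds (by positivity))
  obtain ⟨N₀, hN₀⟩ := eventually_atTop.1 hev
  refine ⟨N₀, fun N hN y hy => ?_⟩
  have h1 := node_mem h h' N
  push_cast at h1
  have hp : node e N < 3 ^ (m * N) := by rw [pow_mul]; exact node_lt e N
  have hBN : (3 : ℝ) ^ (m * N) = (3 ^ m) ^ N := pow_mul _ _ _
  have h2 : |(3 : ℝ) ^ (m * N) * y - 3 ^ (m * N) * Real.ofDigits e| ≤ 1 / 3 ^ m := by
    rw [← mul_sub, abs_mul, abs_of_pos (by positivity), hBN]
    calc _ ≤ ((3 : ℝ) ^ m) ^ N * (1 / 3 ^ m) ^ (N + 1) := by gcongr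
      _ = _ := by rw [pow_succ, ← mul_assoc, ← mul_pow, mul_one_div_cancel hB.ne', one_pow, one_mul]
  rw [← hBN] at h1
  have h3 : (0 : ℝ) < 1 / 3 ^ m := by positivity
  rw [abs_le] at h2
  have := hosc (m * N) (node e N) hp (ε / A * (1 / 3 ^ m) ^ N) (fun i hi => ?_) (Real.ofDigits e) y
    (by linarith) (by linarith) (by linarith) (by linarith)
  · calc _ ≤ _ := this
      _ = _ := by field_simp
  · have := (hN₀ N hN i (Finset.mem_range.2 (Nat.lt_succ_iff.2 hi))).le
    rw [one_div_pow, ← div_eq_mul_one_div, le_div_iff₀ (by positivity), ← hBN]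
    linarith

lemma not_hasDerivAt_of_blocks {a : ℝ} (ha : 0 < a) (ha' : a < 2 / 3) {k m : ℕ} (hm : 1 ≤ m)
    {e : ℕ → Fin (3 ^ m)} (h : ∀ j, 1 ≤ (e j : ℕ)) (h' : ∀ j, (e j : ℕ) + 1 < 3 ^ m)
    (hbig : Tendsto (fun j => 3 ^ (m * j) * |inc a k (m * j) (node e j)|) atTop atTop) :
    ¬ ∃ d : ℝ, HasDerivAt (Mfun k a) d (Real.ofDigits e) := by
  rintro ⟨d, hd⟩
  obtain ⟨N₀, H⟩ := hd.exists_inc_le ha ha' 1 one_pos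
  obtain ⟨N, hN, hlt⟩ := ((eventually_ge_atTop N₀).and
    (hbig.eventually_gt_atTop ((|d| + 1) * (2 * 1 + 1)))).exists
  have hp : node e N < 3 ^ (m * N) := by rw [pow_mul]; exact node_lt e N
  have h1 := node_mem h h' N
  push_cast at h1
  have hBN : (3 : ℝ) ^ (m * N) = (3 ^ m) ^ N := pow_mul _ _ _
  rw [← hBN] at h1
  have h3 : (0 : ℝ) < 1 / 3 ^ m := by positivity
  have := H (m * N) (hN.trans (Nat.le_mul_of_pos_left _ hm)) _ hp
    (by rw [abs_le]; constructor <;> linarith)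
  linarith

/-- A set containing all the points whose `j`-th base-`B` digit is chosen freely among two values
different from `0` and `B - 1` has positive Hausdorff dimension. -/
lemma dimH_pos_of_forall_ofDigits_mem {B : ℕ} {S : Set ℝ} (D : ℕ → Fin 2 → Fin B)
    (hD1 : ∀ j β, 1 ≤ (D j β : ℕ)) (hD2 : ∀ j β, (D j β : ℕ) + 1 < B)
    (hD : ∀ j, D j 0 ≠ D j 1) (hS : ∀ ω : ℕ → Fin 2, Real.ofDigits (fun j => D j (ω j)) ∈ S) :
    0 < dimH S := by
  set x : (ℕ → Fin 2) → ℝ := fun ω => Real.ofDigits fun j => D j (ω j) with hx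
  have hB1 : (1 : ℝ) < B := by
    have h1 := hD1 0 0
    have h2 := hD2 0 0
    exact_mod_cast (by omega : 1 < B)
  have hB0 : (0 : ℝ) < B := by linarith
  have hinjD : ∀ j, Function.Injective (D j) := by
    intro j β γ h
    fin_cases β <;> fin_cases γ
    · rfl
    · exact absurd h (hD j)
    · exact absurd h.symm (hD j)
    · rfl
  set r : ℝ := Real.log 2 / Real.log B with hr
  have hr0 : 0 < r := div_pos (Real.log_pos (by norm_num)) (Real.log_pos hB1)
  have hBr : (B : ℝ) ^ r = 2 := by
    rw [hr, Real.rpow_def_of_pos hB0, mul_div_cancel₀ _ (Real.log_pos hB1).ne',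
      Real.exp_log (by norm_num)]
  have key : ∀ ω ω' : ℕ → Fin 2,
      |Real.ofDigits ω - Real.ofDigits ω'| ≤ 4 * |x ω - x ω'| ^ r := by
    intro ω ω'
    by_cases hω : ω = ω'
    · subst hω
      simp [hr0.ne']
    · have hex : ∃ j, ω j ≠ ω' j := Function.ne_iff.1 hω
      classical
      set j := Nat.find hex with hj
      have hne : ω j ≠ ω' j := Nat.find_spec hex
      have hlt : ∀ i < j, ω i = ω' i := fun i hi => not_not.1 (Nat.find_min hex hi)
      have hnode : node (fun j => D j (ω j)) (j + 1) ≠ node (fun j => D j (ω' j)) (j + 1) := by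
        rw [node, node, node_congr (e := fun j => D j (ω j)) (e' := fun j => D j (ω' j))
          (fun i hi => by simp [hlt i hi])]
        intro h
        exact hne (hinjD j (Fin.ext (Nat.add_left_cancel h)))
      have h1 := one_le_mul_abs_sub_of_node_ne (fun j => hD1 j (ω j)) (fun j => hD2 j (ω j))
        (fun j => hD1 j (ω' j)) (fun j => hD2 j (ω' j)) hnode
      have h2 : (1 : ℝ) ≤ 2 ^ (j + 2) * |x ω - x ω'| ^ r := by
        calc (1 : ℝ) ≤ ((B : ℝ) ^ (j + 1 + 1) * |x ω - x ω'|) ^ r :=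
              Real.one_le_rpow h1 hr0.le
          _ = _ := by
              rw [Real.mul_rpow (by positivity) (abs_nonneg _), ← Real.rpow_natCast,
                ← Real.rpow_mul hB0.le, mul_comm _ r, Real.rpow_mul hB0.le, hBr, Real.rpow_natCast]
      have h3 := Real.abs_ofDigits_sub_ofDigits_le hlt
      push_cast at h3
      refine h3.trans ?_
      rw [inv_le_iff_one_le_mul₀ (by positivity)]
      calc _ ≤ _ := h2
        _ = _ := by ring
  set f : ℝ → ℝ := Real.ofDigits ∘ Function.invFun x with hf
  have hfx : ∀ ω, f (x ω) = Real.ofDigits ω := fun ω => by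
    have h1 := key (Function.invFun x (x ω)) ω
    rw [Function.invFun_eq (f := x) ⟨ω, rfl⟩, sub_self, abs_zero, Real.zero_rpow hr0.ne',
      mul_zero] at h1
    exact sub_eq_zero.1 (abs_nonpos_iff.1 h1)
  have hholder : HolderOnWith 4 r.toNNReal f (range x) := by
    rintro _ ⟨ω, rfl⟩ _ ⟨ω', rfl⟩
    rw [hfx, hfx, edist_dist, edist_dist, Real.dist_eq, Real.dist_eq]
    have h4 : ((4 : NNReal) : ℝ≥0∞) = ENNReal.ofReal 4 := by simp
    rw [h4, Real.coe_toNNReal _ hr0.le, ENNReal.ofReal_rpow_of_nonneg (abs_nonneg _) hr0.le,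
      ← ENNReal.ofReal_mul (by norm_num)]
    exact ENNReal.ofReal_le_ofReal (key ω ω')
  have hsub : Icc (0 : ℝ) 1 ⊆ f '' range x := fun y hy => by
    obtain ⟨ω, -, rfl⟩ := Real.ofDigits_SurjOn (b := 2) (by norm_num) hy
    exact ⟨x ω, ⟨ω, rfl⟩, hfx ω⟩
  have h1 : dimH (Icc (0 : ℝ) 1) = 1 := by
    rw [Real.dimH_of_nonempty_interior (by simp)]
    simp
  have h2 := (dimH_mono hsub).trans (hholder.dimH_image_le (Real.toNNReal_pos.2 hr0))
  rw [h1] at h2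
  refine lt_of_lt_of_le ?_ (dimH_mono (range_subset_iff.2 hS : range x ⊆ S))
  refine pos_iff_ne_zero.2 fun h0 => ?_
  rw [h0, ENNReal.zero_div] at h2
  exact absurd h2 (by simp)

lemma dimH_pos_of_blocks {a : ℝ} (ha : 0 < a) (ha' : a < 2 / 3) {k m : ℕ} (hm : 1 ≤ m)
    (D : ℕ → Fin 2 → ℕ) (hD1 : ∀ j β, 1 ≤ D j β) (hD2 : ∀ j β, D j β + 1 < 3 ^ m)
    (hD : ∀ j, D j 0 ≠ D j 1) (w : ℕ → ℝ[X]) (hw : ∀ j β, incPoly m (D j β) = w j)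
    (hsmall : ∀ i ≤ k, Tendsto (fun j => 3 ^ (m * j) *
      |(derivative^[i] (∏ l ∈ Finset.range j, w l)).eval a|) atTop (𝓝 0))
    (hbig : Tendsto (fun j => 3 ^ (m * j) *
      |(derivative^[k + 1] (∏ l ∈ Finset.range j, w l)).eval a|) atTop atTop) :
    0 < dimH {x ∈ Ioo (0 : ℝ) 1 | HasDerivAt (Mfun k a) 0 x ∧
      ¬ ∃ d : ℝ, HasDerivAt (Mfun (k + 1) a) d x} := by
  let D' : ℕ → Fin 2 → Fin (3 ^ m) := fun j β => ⟨D j β, by have := hD2 j β; omega⟩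
  refine dimH_pos_of_forall_ofDigits_mem D' hD1 hD2
    (fun j h => hD j (congrArg Fin.val h)) fun ω => ?_
  have hinc : ∀ i j, inc a i (m * j) (node (fun j => D' j (ω j)) j) =
      (derivative^[i] (∏ l ∈ Finset.range j, w l)).eval a := fun i j => by
    rw [inc, incPoly_node]
    simp only [D', hw]
  have h1 : ∀ j, 1 ≤ ((fun j => D' j (ω j)) j : ℕ) := fun j => hD1 j _
  have h2 : ∀ j, ((fun j => D' j (ω j)) j : ℕ) + 1 < 3 ^ m := fun j => hD2 j _
  have h3 := ofDigits_mem (e := fun j => D' j (ω j)) (h1 0) (h2 0)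
  have hB : (0 : ℝ) < (3 ^ m : ℕ) := by positivity
  refine ⟨⟨?_, ?_⟩, hasDerivAt_zero_of_blocks ha ha' hm h1 h2 fun i hi => ?_,
    not_hasDerivAt_of_blocks ha ha' hm h1 h2 ?_⟩
  · exact pos_of_mul_pos_right (zero_lt_one.trans_le h3.1) hB.le
  · by_contra! h
    nlinarith
  · simpa only [hinc] using hsmall i hi
  · simpa only [hinc] using hbig

/-- There is a block of ternary digits with weight `X ^ M * (1 - 2 X) ^ (L + 1)` which consists
neither of `0`s only nor of `2`s only. -/
lemma exists_incPoly_eq (M L : ℕ) : ∃ E, 1 ≤ E ∧ E + 1 < 3 ^ (M + L + 1) ∧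
    incPoly (M + L + 1) E = X ^ M * (1 - 2 * X) ^ (L + 1) := by
  induction M with
  | zero =>
    induction L with
    | zero => exact ⟨1, le_rfl, by norm_num, by simp [incPoly, wtPoly]⟩
    | succ L ih =>
      obtain ⟨E, h1, h2, h3⟩ := ih
      refine ⟨3 * E + 1, by omega, ?_, ?_⟩
      · rw [show 0 + (L + 1) + 1 = 0 + L + 1 + 1 by ring, pow_succ]
        omega
      · rw [show 0 + (L + 1) + 1 = 0 + L + 1 + 1 by ring, incPoly,
          show (3 * E + 1) / 3 = E by omega, show (3 * E + 1) % 3 = 1 by omega, h3]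
        simp [wtPoly, pow_succ]
  | succ M ih =>
    obtain ⟨E, h1, h2, h3⟩ := ih
    refine ⟨3 * E, by omega, ?_, ?_⟩
    · rw [show M + 1 + L + 1 = M + L + 1 + 1 by ring, pow_succ]
      omega
    · rw [show M + 1 + L + 1 = M + L + 1 + 1 by ring, incPoly,
        show 3 * E / 3 = E by omega, show 3 * E % 3 = 0 by omega, h3]
      simp [wtPoly, pow_succ]
      ring

lemma exists_pair_incPoly_eq (M L : ℕ) : ∃ D : Fin 2 → ℕ, (∀ β, 1 ≤ D β) ∧
    (∀ β, D β + 1 < 3 ^ (M + L + 2)) ∧ D 0 ≠ D 1 ∧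
    ∀ β, incPoly (M + L + 2) (D β) = X ^ (M + 1) * (1 - 2 * X) ^ (L + 1) := by
  obtain ⟨E, h1, h2, h3⟩ := exists_incPoly_eq M L
  have h4 : 3 ^ (M + L + 2) = 3 ^ (M + L + 1) * 3 := pow_succ _ _
  refine ⟨![3 * E, 3 * E + 2], ?_, ?_, by simp, ?_⟩
  · rw [Fin.forall_fin_two]; exact ⟨by simp; omega, by simp⟩
  · rw [Fin.forall_fin_two, h4]; exact ⟨by simp; omega, by simp; omega⟩
  · have key : ∀ d, d < 3 → d ≠ 1 → incPoly (M + L + 2) (3 * E + d) =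
        X ^ (M + 1) * (1 - 2 * X) ^ (L + 1) := fun d hd hd1 => by
      rw [incPoly, show (3 * E + d) / 3 = E by omega, show (3 * E + d) % 3 = d by omega, h3,
        wtPoly, if_neg hd1]
      ring
    rw [Fin.forall_fin_two]
    exact ⟨key 0 (by norm_num) (by norm_num), key 2 (by norm_num) (by norm_num)⟩

lemma iterate_derivative_one_sub_two_mul_pow (T : ℝ[X]) (n : ℕ) :
    (∀ i < n, (derivative^[i] (T * (1 - 2 * X) ^ n)).eval (1 / 2) = 0) ∧
    (derivative^[n] (T * (1 - 2 * X) ^ n)).eval (1 / 2) =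
      n.factorial * (-2) ^ n * T.eval (1 / 2) := by
  have hw : derivative (1 - 2 * X : ℝ[X]) = C (-2) := by
    simpa [wtPoly] using derivative_wtPoly 1
  induction n with
  | zero => simp
  | succ n ih =>
    have h0 : (1 - 2 * X : ℝ[X]).eval (1 / 2) = 0 := by norm_num
    rw [pow_succ, ← mul_assoc]
    refine ⟨fun i hi => ?_, ?_⟩
    · cases i with
      | zero => simp
      | succ i =>
        rw [eval_iterate_derivative_mul_affine hw, h0, ih.1 i (by omega)]
        simp
    · rw [eval_iterate_derivative_mul_affine hw, h0, ih.2, Nat.factorial_succ]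
      push_cast
      ring

lemma dimH_pos_half (k : ℕ) :
    0 < dimH {x ∈ Ioo (0 : ℝ) 1 | HasDerivAt (Mfun k (1 / 2)) 0 x ∧
      ¬ ∃ d : ℝ, HasDerivAt (Mfun (k + 1) (1 / 2)) d x} := by
  have h10 : incPoly 2 3 = X * (1 - 2 * X) := by simp [incPoly, wtPoly, mul_comm]
  have h12 : incPoly 2 5 = X * (1 - 2 * X) := by simp [incPoly, wtPoly, mul_comm]
  have h02 : incPoly 2 2 = X ^ 2 := by simp [incPoly, wtPoly, sq]
  have h20 : incPoly 2 6 = X ^ 2 := by simp [incPoly, wtPoly, sq]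
  set w : ℕ → ℝ[X] := fun j => if j < k + 1 then X * (1 - 2 * X) else X ^ 2 with hw
  have hprod : ∀ j, ∏ l ∈ Finset.range (j + (k + 1)), w l =
      X ^ (2 * j + (k + 1)) * (1 - 2 * X) ^ (k + 1) := fun j => by
    induction j with
    | zero =>
      rw [zero_add, Finset.prod_congr rfl (g := fun _ => X * (1 - 2 * X))
        fun i hi => if_pos (Finset.mem_range.1 hi)]
      simp [mul_pow]
    | succ j ih =>
      rw [add_right_comm, Finset.prod_range_succ, ih]
      simp only [hw, show ¬ j + (k + 1) < k + 1 by omega, if_false]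
      ring
  refine dimH_pos_of_blocks (m := 2) (by norm_num) (by norm_num) (by norm_num)
    (fun j => if j < k + 1 then ![3, 5] else ![2, 6]) (fun j β => ?_) (fun j β => ?_) (fun j => ?_)
    w (fun j β => ?_) (fun i hi => ?_) ?_
  · fin_cases β <;> split_ifs <;> simp
  · fin_cases β <;> split_ifs <;> simp
  · split_ifs <;> simp
  · simp only [hw]
    fin_cases β <;> split_ifs <;> simp [*]
  · refine tendsto_const_nhds.congr' ?_
    filter_upwards [eventually_ge_atTop (k + 1)] with j hj
    obtain ⟨j, rfl⟩ := Nat.exists_eq_add_of_le' hj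
    rw [hprod, (iterate_derivative_one_sub_two_mul_pow _ _).1 i (by omega)]
    simp
  · rw [← tendsto_add_atTop_iff_nat (k + 1)]
    set c : ℝ := 9 ^ (k + 1) * ((k + 1).factorial * 2 ^ (k + 1) * (1 / 2) ^ (k + 1)) with hc
    have hc0 : 0 < c := by positivity
    refine ((tendsto_pow_atTop_atTop_of_one_lt
      (by norm_num : (1 : ℝ) < 9 / 4)).const_mul_atTop hc0).congr fun j => ?_
    rw [hprod, (iterate_derivative_one_sub_two_mul_pow _ _).2, abs_mul, abs_mul, abs_pow]
    simp only [Polynomial.eval_pow, Polynomial.eval_X, Nat.abs_cast, abs_neg, abs_two, abs_pow]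
    rw [abs_of_pos (by norm_num : (0 : ℝ) < 1 / 2), hc, mul_add 2 j, pow_add 3, pow_mul 3,
      pow_mul 3, pow_add (1 / 2 : ℝ) (2 * j), pow_mul (1 / 2 : ℝ) 2,
      show (9 / 4 : ℝ) = 9 * (1 / 2) ^ 2 by norm_num, mul_pow]
    norm_num
    ring

lemma derivative_pow_mul_one_sub_two_mul_pow (M L : ℕ) :
    X * (1 - 2 * X) * derivative (X ^ M * (1 - 2 * X) ^ L : ℝ[X]) =
      ((M : ℝ[X]) - 2 * ((M : ℝ[X]) + (L : ℝ[X])) * X) * (X ^ M * (1 - 2 * X) ^ L) := by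
  have hX : X * derivative (X ^ M : ℝ[X]) = (M : ℝ[X]) * X ^ M := by
    cases M with
    | zero => simp
    | succ M => rw [Polynomial.derivative_X_pow_succ]; simp; ring
  have hY : (1 - 2 * X) * derivative ((1 - 2 * X) ^ L : ℝ[X]) =
      -2 * (L : ℝ[X]) * (1 - 2 * X) ^ L := by
    have hw : derivative (1 - 2 * X : ℝ[X]) = -2 := by simp [Polynomial.derivative_mul]
    cases L with
    | zero => simp
    | succ L => rw [Polynomial.derivative_pow_succ, hw]; simp; ring
  rw [Polynomial.derivative_mul]
  linear_combination (1 - 2 * X) * (1 - 2 * X) ^ L * hX + X * X ^ M * hY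

lemma iterate_derivative_recurrence {T : ℝ[X]} {M n : ℕ}
    (h : X * (1 - 2 * X) * derivative T = ((M : ℝ[X]) - 2 * (n : ℝ[X]) * X) * T) (i : ℕ) :
    X * (1 - 2 * X) * derivative^[i + 2] T =
      ((M : ℝ[X]) - 2 * (n : ℝ[X]) * X) * derivative^[i + 1] T
      - ((i : ℝ[X]) + 1) * (1 - 4 * X) * derivative^[i + 1] T
      - 2 * ((i : ℝ[X]) + 1) * ((n : ℝ[X]) - (i : ℝ[X])) * derivative^[i] T := by
  induction i with
  | zero =>
    have := congrArg derivative h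
    simp [Polynomial.derivative_mul] at this
    simp
    linear_combination this
  | succ i ih =>
    have := congrArg derivative ih
    simp only [Polynomial.derivative_mul, Polynomial.derivative_sub, Polynomial.derivative_add,
      Polynomial.derivative_X, Polynomial.derivative_one, Polynomial.derivative_natCast,
      Polynomial.derivative_ofNat, ← Function.iterate_succ_apply' derivative] at this
    push_cast
    linear_combination this

lemma exists_bound_iterate_derivative {a : ℝ} (ha : 0 < a) (ha' : a < 2 / 3) (ha2 : a ≠ 1 / 2)
    (i : ℕ) : ∃ K E : ℝ, 0 ≤ K ∧ 0 ≤ E ∧ ∀ (T : ℝ[X]) (M n : ℕ), 1 ≤ n → M ≤ n →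
      X * (1 - 2 * X) * derivative T = ((M : ℝ[X]) - 2 * (n : ℝ[X]) * X) * T →
      |(derivative^[i] T).eval a| ≤ K * n ^ i * |T.eval a| ∧
      |a * (1 - 2 * a) * (derivative^[i + 1] T).eval a
        - (M - 2 * n * a) * (derivative^[i] T).eval a| ≤ E * n ^ i * |T.eval a| := by
  have hp : 0 < |a * (1 - 2 * a)| :=
    abs_pos.2 (mul_ne_zero ha.ne' fun h => ha2 (by linarith))
  induction i with
  | zero =>
    refine ⟨1, 0, by simp, le_rfl, fun T M n hn hM h => ⟨by simp, ?_⟩⟩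
    have := congrArg (eval a) h
    simp at this
    simp [this]
  | succ i ih =>
    obtain ⟨K, E, hK, hE, H⟩ := ih
    set K' := (3 * K + E) / |a * (1 - 2 * a)| with hK'
    have hK'0 : 0 ≤ K' := by positivity
    refine ⟨K', 4 * (i + 1) * K' + 2 * (i + 1) * (i + 1) * K, hK'0, by positivity,
      fun T M n hn hM h => ?_⟩
    obtain ⟨h1, h2⟩ := H T M n hn hM h
    have hn1 : (1 : ℝ) ≤ n := by exact_mod_cast hn
    have hMn : (M : ℝ) ≤ n := by exact_mod_cast hM
    have hM0 : (0 : ℝ) ≤ M := Nat.cast_nonneg _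
    have hZ : |M - 2 * n * a| ≤ 3 * n := by
      rw [abs_le]; constructor <;> nlinarith
    set v := |T.eval a|
    have hv : 0 ≤ v := abs_nonneg _
    have hb : |(derivative^[i + 1] T).eval a| ≤ K' * n ^ (i + 1) * v := by
      have h3 : |a * (1 - 2 * a)| * |(derivative^[i + 1] T).eval a| ≤
          (3 * K + E) * n ^ (i + 1) * v := by
        rw [← abs_mul]
        calc _ = |(a * (1 - 2 * a) * (derivative^[i + 1] T).eval a
                - (M - 2 * n * a) * (derivative^[i] T).eval a)
                + (M - 2 * n * a) * (derivative^[i] T).eval a| := by ring_nf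
          _ ≤ E * n ^ i * v + 3 * n * (K * n ^ i * v) := by
            refine (abs_add_le _ _).trans (add_le_add h2 ?_)
            rw [abs_mul]
            gcongr
          _ ≤ E * (n ^ i * n) * v + 3 * n * (K * n ^ i * v) := by
            gcongr
            exact le_mul_of_one_le_right (by positivity) hn1
          _ = _ := by ring
      rw [hK', div_mul_eq_mul_div, div_mul_eq_mul_div, le_div_iff₀ hp, mul_comm]
      exact h3
    refine ⟨hb, ?_⟩
    have h4 := congrArg (eval a) (iterate_derivative_recurrence h i)
    simp only [Polynomial.eval_mul, Polynomial.eval_sub, Polynomial.eval_add, Polynomial.eval_X,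
      Polynomial.eval_one, Polynomial.eval_natCast, Polynomial.eval_ofNat] at h4
    rw [h4]
    have ha4 : |1 - 4 * a| ≤ 4 := by rw [abs_le]; constructor <;> linarith
    have hni : |(n : ℝ) - i| ≤ (i + 1) * n := by
      have : (0 : ℝ) ≤ i := Nat.cast_nonneg _
      rw [abs_le]; constructor <;> nlinarith
    calc _ = |(i + 1) * (1 - 4 * a) * (derivative^[i + 1] T).eval a
          + 2 * (i + 1) * (n - i) * (derivative^[i] T).eval a| := by
          rw [← abs_neg]; ring_nf
      _ ≤ (i + 1) * 4 * (K' * n ^ (i + 1) * v) +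
          2 * (i + 1) * ((i + 1) * n) * (K * n ^ i * v) := by
        have hi : |(i : ℝ) + 1| = i + 1 := abs_of_pos (by positivity)
        refine (abs_add_le _ _).trans (add_le_add ?_ ?_)
        · rw [abs_mul, abs_mul, hi]
          gcongr
        · rw [abs_mul, abs_mul, abs_mul, hi, abs_two]
          gcongr
      _ = _ := by ring

lemma exists_lower_bound_iterate_derivative {a : ℝ} (ha : 0 < a) (ha' : a < 2 / 3)
    (ha2 : a ≠ 1 / 2) {c : ℝ} (hc : 0 < c) (i : ℕ) :
    ∃ c' : ℝ, 0 < c' ∧ ∃ N : ℝ, ∀ (T : ℝ[X]) (M n : ℕ), 1 ≤ n → M ≤ n →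
      X * (1 - 2 * X) * derivative T = ((M : ℝ[X]) - 2 * (n : ℝ[X]) * X) * T → N ≤ n →
      c * n ≤ |M - 2 * n * a| → c' * n ^ i * |T.eval a| ≤ |(derivative^[i] T).eval a| := by
  have hp : 0 < |a * (1 - 2 * a)| :=
    abs_pos.2 (mul_ne_zero ha.ne' fun h => ha2 (by linarith))
  induction i with
  | zero => exact ⟨1, one_pos, 0, fun T M n _ _ _ _ _ => by simp⟩
  | succ i ih =>
    obtain ⟨c', hc', N, H⟩ := ih
    obtain ⟨K, E, -, hE, H'⟩ := exists_bound_iterate_derivative ha ha' ha2 i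
    refine ⟨c * c' / 2 / |a * (1 - 2 * a)|, by positivity, max N (2 * E / (c * c')),
      fun T M n hn hM h hN hZ => ?_⟩
    have h1 := H T M n hn hM h ((le_max_left _ _).trans hN) hZ
    have h2 := (H' T M n hn hM h).2
    have hEn : E ≤ c * c' / 2 * n := by
      have := (le_max_right _ _).trans hN
      rw [div_le_iff₀ (by positivity)] at this
      linarith
    set v := |T.eval a|
    have hv : 0 ≤ v := abs_nonneg _
    rw [div_mul_eq_mul_div, div_mul_eq_mul_div, div_le_iff₀ hp, mul_comm |(_ : ℝ)|, ← abs_mul]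
    rw [abs_sub_comm] at h2
    have h3 := (abs_sub_abs_le_abs_sub _ _).trans h2
    rw [abs_mul ((M : ℝ) - _)] at h3
    have h4 : c * n * (c' * n ^ i * v) ≤
        |M - 2 * n * a| * |(derivative^[i] T).eval a| := by gcongr
    have h5 : E * n ^ i * v ≤ c * c' / 2 * n * n ^ i * v := by gcongr
    calc _ = c * n * (c' * n ^ i * v) - c * c' / 2 * n * n ^ i * v := by ring
      _ ≤ _ := by linarith

/-- A greedy choice of steps of two opposite signs follows any slowly decreasing sequence up to
a bounded error. -/
lemma exists_greedy_sum {lam : Bool → ℝ} (h1 : 0 < lam true) (h2 : lam false < 0) {T : ℕ → ℝ}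
    (hT : ∀ j, T (j + 1) ≤ T j) (hT' : ∀ j, T j - T (j + 1) ≤ -lam false) :
    ∃ c : ℕ → Bool, ∃ K : ℝ, ∀ j, |∑ i ∈ Finset.range j, lam (c i) - T j| ≤ K := by
  classical
  let S : ℕ → ℝ := fun n =>
    Nat.rec (motive := fun _ => ℝ) 0 (fun j s => s + lam (decide (s ≤ T j))) n
  have hS : ∀ j, S (j + 1) = S j + lam (decide (S j ≤ T j)) := fun j => rfl
  have hsum : ∀ j, ∑ i ∈ Finset.range j, lam (decide (S i ≤ T i)) = S j := fun j => by
    induction j with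
    | zero => rfl
    | succ j ih => rw [Finset.sum_range_succ, ih, hS]
  refine ⟨fun i => decide (S i ≤ T i), |S 0 - T 0| + lam true - lam false, fun j => ?_⟩
  rw [hsum]
  have h0 := abs_nonneg (S 0 - T 0)
  induction j with
  | zero => linarith
  | succ j ih =>
    have := hT j
    have := hT' j
    rw [abs_le] at ih ⊢
    rw [hS]
    by_cases h : S j ≤ T j
    · simp only [h, decide_true]
      constructor <;> linarith
    · simp only [h, decide_false]
      push Not at h
      constructor <;> linarith

lemma exists_blocks_of_mul_neg {α β : ℝ} (h : α * β < 0) : ∃ (M L : Bool → ℕ) (m : ℕ),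
    (∀ b, M b + L b + 2 = m) ∧
    0 < (M true + 1) * α + (L true + 1) * β ∧ (M false + 1) * α + (L false + 1) * β < 0 := by
  rcases mul_neg_iff.1 h with ⟨h1, h2⟩ | ⟨h1, h2⟩
  · obtain ⟨s, hs⟩ := exists_nat_gt (max (-β / α) (α / -β))
    have h3 := (le_max_left _ _).trans_lt hs
    have h4 := (le_max_right _ _).trans_lt hs
    rw [div_lt_iff₀ h1] at h3
    rw [div_lt_iff₀ (by linarith)] at h4
    refine ⟨fun b => if b then s else 0, fun b => if b then 0 else s, s + 2, ?_, ?_, ?_⟩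
    · simp
    · simp; nlinarith
    · simp; nlinarith
  · obtain ⟨s, hs⟩ := exists_nat_gt (max (-α / β) (β / -α))
    have h3 := (le_max_left _ _).trans_lt hs
    have h4 := (le_max_right _ _).trans_lt hs
    rw [div_lt_iff₀ h2] at h3
    rw [div_lt_iff₀ (by linarith)] at h4
    refine ⟨fun b => if b then 0 else s, fun b => if b then s else 0, s + 2, ?_, ?_, ?_⟩
    · simp
    · simp; nlinarith
    · simp; nlinarith

lemma log_mul_log_neg {a : ℝ} (ha : 0 < a) (ha' : a < 2 / 3) (ha3 : a ≠ 1 / 3) (ha2 : a ≠ 1 / 2) :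
    Real.log (3 * a) * Real.log (3 * |1 - 2 * a|) < 0 := by
  have h0 : 0 < |1 - 2 * a| := abs_pos.2 fun h => ha2 (by linarith)
  rcases lt_or_gt_of_ne ha3 with h | h
  · refine mul_neg_of_neg_of_pos (Real.log_neg (by linarith) (by linarith)) (Real.log_pos ?_)
    rw [abs_of_pos (by linarith)]
    linarith
  · refine mul_neg_of_pos_of_neg (Real.log_pos (by linarith)) (Real.log_neg (by linarith) ?_)
    have : |1 - 2 * a| < 1 / 3 := by rw [abs_lt]; constructor <;> linarith
    linarith

lemma sub_one_lt_mul_log {t : ℝ} (ht : 0 < t) (ht1 : t ≠ 1) : t - 1 < t * Real.log t := by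
  have h := Real.log_lt_sub_one_of_pos (inv_pos.2 ht) (by simpa using ht1)
  rw [Real.log_inv] at h
  have := mul_lt_mul_of_pos_left h ht
  rw [mul_sub, mul_inv_cancel₀ ht.ne'] at this
  linarith

/-- The exponential growth rate of `(3 a) ^ M * (3 |1 - 2 a|) ^ L` at digit frequencies
`2 a` and `1 - 2 a` is positive. -/
lemma growth_rate_pos {a : ℝ} (ha : 0 < a) (ha' : a < 2 / 3) (ha3 : a ≠ 1 / 3) (ha2 : a ≠ 1 / 2) :
    0 < 2 * a * Real.log (3 * a) + (1 - 2 * a) * Real.log (3 * |1 - 2 * a|) := by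
  rcases lt_or_gt_of_ne ha2 with h | h
  · rw [abs_of_pos (by linarith)]
    have h1 := sub_one_lt_mul_log (t := 3 * a) (by linarith) (fun h => ha3 (by linarith))
    have h2 := sub_one_lt_mul_log (t := 3 * (1 - 2 * a)) (by linarith)
      (fun h => ha3 (by linarith))
    linarith
  · have h1 := Real.log_pos (show 1 < 3 * a by linarith)
    have h2 : Real.log (3 * |1 - 2 * a|) < 0 := by
      rw [abs_of_neg (by linarith)]
      exact Real.log_neg (by linarith) (by linarith)
    nlinarith [mul_pos ha h1, mul_pos_of_neg_of_neg (show 1 - 2 * a < 0 by linarith) h2]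

lemma three_pow_mul_abs_eval {a : ℝ} (ha : 0 < a) (ha2 : a ≠ 1 / 2) (M L : ℕ) :
    3 ^ (M + L) * |(X ^ M * (1 - 2 * X) ^ L : ℝ[X]).eval a| =
      Real.exp (M * Real.log (3 * a) + L * Real.log (3 * |1 - 2 * a|)) := by
  have h0 : 0 < |1 - 2 * a| := abs_pos.2 fun h => ha2 (by linarith)
  rw [Real.exp_add, Real.exp_nat_mul, Real.exp_nat_mul, Real.exp_log (by positivity),
    Real.exp_log (by positivity)]
  simp [abs_mul, abs_pow, abs_of_pos ha]
  ring

lemma eventually_add_mul_log_le (K b : ℝ) (N : ℕ) {κ : ℝ} (hκ : 0 < κ) :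
    ∀ᶠ j : ℕ in atTop, K + b * Real.log (j + N) ≤ κ * j := by
  have ht : Tendsto (fun j : ℕ => (j : ℝ) + N) atTop atTop :=
    tendsto_atTop_add_const_right _ _ tendsto_natCast_atTop_atTop
  have hδ : 0 < κ / (4 * (|b| + 1)) := by positivity
  filter_upwards [ht.eventually (Real.isLittleO_log_id_atTop.bound hδ), eventually_ge_atTop N,
    tendsto_natCast_atTop_atTop.eventually_ge_atTop (2 * K / κ)] with j h1 h2 h3
  have h2' : (N : ℝ) ≤ j := by exact_mod_cast h2
  rw [div_le_iff₀ hκ] at h3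
  simp only [id, Real.norm_eq_abs] at h1
  rw [abs_of_nonneg (by positivity : (0 : ℝ) ≤ j + N)] at h1
  have h4 : b * Real.log (j + N) ≤ (|b| + 1) * (κ / (4 * (|b| + 1)) * (j + N)) := by
    refine (le_abs_self _).trans ?_
    rw [abs_mul]
    gcongr
    linarith
  have h5 : (|b| + 1) * (κ / (4 * (|b| + 1)) * (j + N)) = κ / 4 * (j + N) := by
    field_simp
  nlinarith

lemma dimH_pos_of_ne_half {a : ℝ} (ha : 0 < a) (ha' : a < 2 / 3) (ha3 : a ≠ 1 / 3)
    (ha2 : a ≠ 1 / 2) (k : ℕ) :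
    0 < dimH {x ∈ Ioo (0 : ℝ) 1 | HasDerivAt (Mfun k a) 0 x ∧
      ¬ ∃ d : ℝ, HasDerivAt (Mfun (k + 1) a) d x} := by
  have hαβ := log_mul_log_neg ha ha' ha3 ha2
  have hκ := growth_rate_pos ha ha' ha3 ha2
  have hexp := three_pow_mul_abs_eval ha ha2
  set α := Real.log (3 * a)
  set β := Real.log (3 * |1 - 2 * a|)
  set κ := 2 * a * α + (1 - 2 * a) * β with hκdef
  obtain ⟨M₀, L₀, m, hm, hpos, hneg⟩ := exists_blocks_of_mul_neg hαβ
  have hm1 : 1 ≤ m := by have := hm true; omega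
  have hDex := fun b => exists_pair_incPoly_eq (M₀ b) (L₀ b)
  simp only [hm] at hDex
  choose D hD1 hD2 hD hDw using hDex
  set lam : Bool → ℝ := fun b => (M₀ b + 1) * α + (L₀ b + 1) * β with hlam
  obtain ⟨N₀, hN₀⟩ := exists_nat_gt (max 1 ((k + 1 / 2 : ℝ) / -lam false))
  have hN1 : (1 : ℝ) < N₀ := (le_max_left _ _).trans_lt hN₀
  have hN2 := (le_max_right _ _).trans_lt hN₀
  rw [div_lt_iff₀ (neg_pos.2 hneg)] at hN2
  have ht0 : ∀ j : ℕ, (1 : ℝ) < j + N₀ := fun j => by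
    have : (0 : ℝ) ≤ j := Nat.cast_nonneg _
    linarith
  set T : ℕ → ℝ := fun j => -((k + 1 / 2) * Real.log (j + N₀)) with hT
  obtain ⟨c, K, hc⟩ := exists_greedy_sum (lam := lam) hpos hneg (T := T)
    (fun j => by
      have h1 := ht0 j
      simp only [hT, neg_le_neg_iff]
      push_cast
      gcongr
      linarith)
    (fun j => by
      have h1 := ht0 j
      have h2 := ht0 (j + 1)
      have h3 : Real.log ((j + 1 : ℕ) + N₀) - Real.log (j + N₀) ≤ 1 / (j + N₀) := by
        rw [← Real.log_div (by linarith) (by linarith)]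
        refine (Real.log_le_sub_one_of_pos (div_pos (by linarith) (by linarith))).trans
          (le_of_eq ?_)
        have : (j + N₀ : ℝ) ≠ 0 := by linarith
        field_simp
        push_cast
        ring
      have h4 : (k + 1 / 2 : ℝ) * (1 / (j + N₀)) ≤ -lam false := by
        rw [mul_one_div, div_le_iff₀ (by linarith)]
        refine hN2.le.trans ?_
        rw [mul_comm]
        refine mul_le_mul_of_nonneg_left ?_ (neg_pos.2 hneg).le
        have : (0 : ℝ) ≤ j := Nat.cast_nonneg _
        linarith
      have h5 := mul_le_mul_of_nonneg_left h3 (by positivity : (0 : ℝ) ≤ k + 1 / 2)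
      simp only [hT]
      linarith)
  set M : ℕ → ℕ := fun j => ∑ i ∈ Finset.range j, (M₀ (c i) + 1) with hM
  set L : ℕ → ℕ := fun j => ∑ i ∈ Finset.range j, (L₀ (c i) + 1) with hL
  have hML : ∀ j, M j + L j = m * j := fun j => by
    rw [hM, hL, ← Finset.sum_add_distrib, Finset.sum_congr rfl (g := fun _ => m)
      fun i _ => by have := hm (c i); omega]
    simp [mul_comm]
  have hMLr : ∀ j, (M j : ℝ) + L j = m * j := fun j => by exact_mod_cast hML j
  have hW : ∀ j, ∑ i ∈ Finset.range j, lam (c i) = M j * α + L j * β := fun j => by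
    simp only [hlam, hM, hL, Finset.sum_add_distrib, ← Finset.sum_mul, Nat.cast_sum, Nat.cast_add,
      Nat.cast_one]
  simp only [hW, abs_le] at hc
  set w : ℕ → ℝ[X] := fun j => X ^ (M₀ (c j) + 1) * (1 - 2 * X) ^ (L₀ (c j) + 1) with hw
  have hprod : ∀ j, ∏ l ∈ Finset.range j, w l = X ^ M j * (1 - 2 * X) ^ L j := fun j => by
    rw [hw, Finset.prod_mul_distrib, Finset.prod_pow_eq_pow_sum, Finset.prod_pow_eq_pow_sum]
  have hlogder : ∀ j, X * (1 - 2 * X) * derivative (X ^ M j * (1 - 2 * X) ^ L j : ℝ[X]) =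
      ((M j : ℝ[X]) - 2 * ((m * j : ℕ) : ℝ[X]) * X) * (X ^ M j * (1 - 2 * X) ^ L j) := fun j => by
    rw [derivative_pow_mul_one_sub_two_mul_pow, ← hML]
    push_cast
    rfl
  have hexp' : ∀ j, 3 ^ (m * j) * |(X ^ M j * (1 - 2 * X) ^ L j : ℝ[X]).eval a| =
      Real.exp (M j * α + L j * β) := fun j => by rw [← hML, hexp]
  have hMn : ∀ j, M j ≤ m * j := fun j => by rw [← hML]; omega
  have htend : Tendsto (fun j : ℕ => (j : ℝ) + N₀) atTop atTop :=
    tendsto_atTop_add_const_right _ _ tendsto_natCast_atTop_atTop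
  have hpow : ∀ (i j : ℕ), ((j : ℝ) + N₀) ^ i * Real.exp (T j) =
      Real.exp ((i - k - 1 / 2) * Real.log (j + N₀)) := fun i j => by
    have h1 := ht0 j
    nth_rewrite 1 [← Real.exp_log (by linarith : (0 : ℝ) < j + N₀)]
    rw [← Real.exp_nat_mul, ← Real.exp_add]
    congr 1
    ring
  refine dimH_pos_of_blocks ha ha' hm1 (fun j => D (c j)) (fun j => hD1 _) (fun j => hD2 _)
    (fun j => hD _) w (fun j => hDw _) (fun i hi => ?_) ?_
  · obtain ⟨A, _, hA, -, H⟩ := exists_bound_iterate_derivative ha ha' ha2 i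
    have hlim : Tendsto (fun j : ℕ => A * m ^ i * Real.exp K *
        Real.exp (((k : ℕ) - k - 1 / 2) * Real.log (j + N₀))) atTop (𝓝 0) := by
      rw [← mul_zero (A * m ^ i * Real.exp K)]
      refine (Real.tendsto_exp_atBot.comp ?_).const_mul _
      exact (Real.tendsto_log_atTop.comp htend).const_mul_atTop_of_neg (by norm_num)
    refine squeeze_zero' (Eventually.of_forall fun j => by positivity) ?_ hlim
    filter_upwards [eventually_ge_atTop 1] with j hj
    have h1 := ht0 j
    have h2 := (H _ (M j) (m * j) (Nat.mul_pos hm1 hj) (hMn j) (hlogder j)).1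
    rw [hprod, ← hpow]
    have h3 : M j * α + L j * β ≤ K + T j := by linarith [(hc j).2]
    calc _ ≤ 3 ^ (m * j) * (A * ((m * j : ℕ) : ℝ) ^ i *
          |(X ^ M j * (1 - 2 * X) ^ L j : ℝ[X]).eval a|) := by gcongr
      _ = A * m ^ i * j ^ i * (3 ^ (m * j) *
          |(X ^ M j * (1 - 2 * X) ^ L j : ℝ[X]).eval a|) := by push_cast; ring
      _ ≤ A * m ^ i * (j + N₀) ^ i * (Real.exp K * Real.exp (T j)) := by
        rw [hexp', ← Real.exp_add]
        gcongr
        linarith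
      _ ≤ A * m ^ i * (j + N₀) ^ k * (Real.exp K * Real.exp (T j)) := by
        gcongr
        exact h1.le
      _ = _ := by ring
  · have hne : 0 < |α - β| := abs_pos.2 fun h => by
      rw [sub_eq_zero.1 h] at hαβ
      nlinarith [mul_self_nonneg β]
    have hc0 : 0 < κ / 2 / |α - β| := by positivity
    obtain ⟨A, hA, N, H⟩ := exists_lower_bound_iterate_derivative ha ha' ha2 hc0 (k + 1)
    have hlim : Tendsto (fun j : ℕ => A / 2 ^ (k + 1) * Real.exp (-K) *
        Real.exp (((k + 1 : ℕ) - k - 1 / 2) * Real.log (j + N₀))) atTop atTop := by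
      refine (Real.tendsto_exp_atTop.comp ?_).const_mul_atTop (by positivity)
      refine (Real.tendsto_log_atTop.comp htend).const_mul_atTop ?_
      push_cast
      linarith
    refine tendsto_atTop_mono' _ ?_ hlim
    filter_upwards [eventually_ge_atTop 1, tendsto_natCast_atTop_atTop.eventually_ge_atTop (N₀ : ℝ),
      tendsto_natCast_atTop_atTop.eventually_ge_atTop N,
      eventually_add_mul_log_le K (k + 1 / 2) N₀ (half_pos hκ)] with j hj hjN hjN' hlog
    have h1 := ht0 j
    have hmj : (j : ℝ) ≤ (m * j : ℕ) := by exact_mod_cast Nat.le_mul_of_pos_left j hm1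
    have hc1 := (hc j).1
    have hc2 := (hc j).2
    have hZ : κ / 2 / |α - β| * (m * j : ℕ) ≤ |M j - 2 * (m * j : ℕ) * a| := by
      rw [div_mul_eq_mul_div, div_le_iff₀ hne, ← abs_mul]
      have hdecomp : ((M j : ℝ) - 2 * (m * j : ℕ) * a) * (α - β) =
          (M j * α + L j * β) - (m * j : ℕ) * κ := by
        have := hMLr j
        push_cast
        rw [hκdef]
        linear_combination -β * this
      rw [hdecomp]
      refine le_trans ?_ (neg_le_abs _)
      have hTj : T j = -((k + 1 / 2) * Real.log (j + N₀)) := rfl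
      have hlog0 : 0 ≤ (k + 1 / 2 : ℝ) * Real.log (j + N₀) :=
        mul_nonneg (by positivity) (Real.log_nonneg h1.le)
      have := mul_le_mul_of_nonneg_left hmj (half_pos hκ).le
      linarith
    have h2 := H _ (M j) (m * j) (Nat.mul_pos hm1 hj) (hMn j) (hlogder j) (hjN'.trans hmj) hZ
    rw [hprod, ← hpow]
    have h3 : -K + T j ≤ M j * α + L j * β := by linarith
    calc _ = A * ((j + N₀) / 2) ^ (k + 1) * (Real.exp (-K) * Real.exp (T j)) := by
          rw [div_pow]; ring
      _ ≤ A * ((m * j : ℕ) : ℝ) ^ (k + 1) * Real.exp (M j * α + L j * β) := by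
        rw [← Real.exp_add]
        gcongr
        linarith
      _ = 3 ^ (m * j) * (A * ((m * j : ℕ) : ℝ) ^ (k + 1) *
          |(X ^ M j * (1 - 2 * X) ^ L j : ℝ[X]).eval a|) := by rw [← hexp']; ring
      _ ≤ _ := by gcongr

lemma dimH_pos {a : ℝ} (ha : 0 < a) (ha' : a < 2 / 3) (ha3 : a ≠ 1 / 3) (k : ℕ) :
    0 < dimH {x ∈ Ioo (0 : ℝ) 1 | HasDerivAt (Mfun k a) 0 x ∧
      ¬ ∃ d : ℝ, HasDerivAt (Mfun (k + 1) a) d x} := by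
  by_cases h : a = 1 / 2
  · rw [h]
    exact dimH_pos_half k
  · exact dimH_pos_of_ne_half ha ha' ha3 h k

end

/-- for `a ∈ (0,2/3)`, `a ≠ 1/3`, and every `k ≥ 1`, the set of `x` with
`M_{k,a}'(x) = 0` but no finite derivative of `M_{k+1,a}` at `x` has positive Hausdorff
dimension (in particular it is uncountable); consequently `D⁰_{0,a} ⊋ D⁰_{1,a} ⊋ ⋯`. -/
theorem stmt14 (a : ℝ) (ha : 0 < a) (ha' : a < 2/3) (ha'' : a ≠ 1/3) :
    (∀ k : ℕ, 1 ≤ k →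
      0 < dimH {x ∈ Set.Ioo (0:ℝ) 1 | HasDerivAt (Mfun k a) 0 x ∧
          ¬ ∃ d : ℝ, HasDerivAt (Mfun (k + 1) a) d x} ∧
      ¬ ({x ∈ Set.Ioo (0:ℝ) 1 | HasDerivAt (Mfun k a) 0 x ∧
          ¬ ∃ d : ℝ, HasDerivAt (Mfun (k + 1) a) d x}).Countable) ∧
    (∀ k : ℕ, {x ∈ Set.Ioo (0:ℝ) 1 | HasDerivAt (Mfun (k + 1) a) 0 x}
        ⊂ {x ∈ Set.Ioo (0:ℝ) 1 | HasDerivAt (Mfun k a) 0 x}) := by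
  refine ⟨fun k _ => ?_, fun k => ?_⟩
  · have h := dimH_pos ha ha' ha'' k
    exact ⟨h, fun hc => h.ne' hc.dimH_zero⟩
  · refine ⟨fun x hx => ⟨hx.1, hx.2.Mfun_of_succ ha ha' hx.1⟩, fun hsub => ?_⟩
    have hne : {x ∈ Ioo (0 : ℝ) 1 | HasDerivAt (Mfun k a) 0 x ∧
        ¬ ∃ d : ℝ, HasDerivAt (Mfun (k + 1) a) d x}.Nonempty := by
      rw [nonempty_iff_ne_empty]
      intro h0
      have := dimH_pos ha ha' ha'' k
      rw [h0, dimH_empty] at this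
      exact lt_irrefl _ this
    obtain ⟨x, hx, h1, h2⟩ := hne
    exact h2 ⟨0, (hsub ⟨hx, h1⟩).2⟩
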